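/- In the asymptotically Schwarzschild coordinates (0<M≤M₀ for a sufficiently small absolute constant M₀), with q=r−t and q*=r*−t, the following hold with constants independent of M, t, x. (i) For all multiindices α, I and every smooth φ: |∂^α Z^I ((∂̃_a−∂_a)φ)| ≤ C M (1+ln(1+t+r))(1+t+r)^{−1} Σ_{|J|≤|I|, |β|≤|α|} |∂ ∂^β Z^J φ| (for each a=0,…,3). (ii) (1+ M ln(1+r)/(1+|q*|))^{−1} ≤ C (1+|q*|)/(1+|q|) and (1+|q*|)/(1+|q|) ≤ C (1+ M ln(1+r)/(1+|q|)). (iii) For every k there is C=C(k) with C^{−1}(1+ M ln(1+r)/(1+|q*|))^{−k} Σ_{|I|≤k}|Z^Iφ| ≤ Σ_{|I|≤k}|X̃^Iφ| ≤ C (1+ M ln(1+r)/(1+|q|))^{k} Σ_{|I|≤k}|Z^Iφ|, for every smooth φ, where X̃^I are products of modified vector fields and Z^I products of Minkowski vector fields. -/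

import Mathlib

noncomputable section
open MeasureTheory

abbrev E3 : Type := EuclideanSpace ℝ (Fin 3)
abbrev Spt : Type := ℝ × E3

/-- The coordinate basis directions of `ℝ^{1+3}`. -/
def dir (a : Fin 4) : Spt :=
  Fin.cases ((1:ℝ), (0:E3)) (fun i => ((0:ℝ), EuclideanSpace.single i (1:ℝ))) a

/-- Coordinate partial derivative `∂_a`. -/
def pd (a : Fin 4) (f : Spt → ℝ) (p : Spt) : ℝ := fderiv ℝ f p (dir a)

def toVec (c : Fin 4 → ℝ) : Spt := ∑ a : Fin 4, c a • dir a

/-- The japanese bracket `⟨s⟩ = 1 + |s|`. -/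
def jap (s : ℝ) : ℝ := 1 + |s|

/-- ω = x/|x| -/
def omg (p : Spt) : E3 := ‖p.2‖⁻¹ • p.2

def Ldir (p : Spt) : Spt := ((1:ℝ), omg p)
def Lbardir (p : Spt) : Spt := ((1:ℝ), -omg p)
def qdir (p : Spt) : Spt := (-(1:ℝ)/2, (2⁻¹:ℝ) • omg p)
def angDir (i : Fin 3) (p : Spt) : Spt :=
  ((0:ℝ), EuclideanSpace.single i (1:ℝ) - omg p i • omg p)

/-- The Minkowski metric (= its inverse) `diag(-1,1,1,1)`. -/
def eta (a b : Fin 4) : ℝ := if a = b then (if a = 0 then -1 else 1) else 0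

def Llow (p : Spt) (a : Fin 4) : ℝ := Fin.cases (-1:ℝ) (fun i => omg p i) a
def Lup (p : Spt) (a : Fin 4) : ℝ := Fin.cases (1:ℝ) (fun i => omg p i) a
def Lbarlow (p : Spt) (a : Fin 4) : ℝ := Fin.cases (-1:ℝ) (fun i => -omg p i) a
def Lbarup (p : Spt) (a : Fin 4) : ℝ := Fin.cases (1:ℝ) (fun i => -omg p i) a

/-- Index type for the Minkowski commuting vector fields: translations,
rotations/boosts, scaling. -/
abbrev ZIdx : Type := Fin 4 ⊕ (Fin 4 × Fin 4) ⊕ Unit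

def xlow (p : Spt) (a : Fin 4) : ℝ := Fin.cases (-p.1) (fun i => p.2 i) a
def xup (p : Spt) (a : Fin 4) : ℝ := Fin.cases p.1 (fun i => p.2 i) a

/-- The components of the Minkowski commuting vector fields. -/
def zfield : ZIdx → Spt → Fin 4 → ℝ
  | Sum.inl a => fun _ c => if c = a then 1 else 0
  | Sum.inr (Sum.inl ab) => fun p c =>
      xlow p ab.1 * (if c = ab.2 then 1 else 0) - xlow p ab.2 * (if c = ab.1 then 1 else 0)
  | Sum.inr (Sum.inr _) => fun p => xup p

/-- `Z^I` applied to a scalar function. -/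
def zApply : {k : ℕ} → (Fin k → ZIdx) → (Spt → ℝ) → Spt → ℝ
  | 0, _, f => f
  | _+1, I, f => fun p => fderiv ℝ (zApply (fun j => I j.succ) f) p (toVec (zfield (I 0) p))

/-- `∂^β` applied to a scalar function. -/
def pdT : {k : ℕ} → (Fin k → Fin 4) → (Spt → ℝ) → Spt → ℝ
  | 0, _, f => f
  | _+1, β, f => pd (β 0) (pdT (fun j => β j.succ) f)

def pdd (a b : Fin 4) (f : Spt → ℝ) : Spt → ℝ := pd a (pd b f)

/-- The flat wave operator `□ = -∂_t² + Δ`. -/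
def box (f : Spt → ℝ) (p : Spt) : ℝ := -(pdd 0 0 f p) + ∑ i : Fin 3, pdd i.succ i.succ f p


/-- Kronecker delta. -/
def kron (a b : Fin 4) : ℝ := if a = b then 1 else 0

/-- The asymptotically Schwarzschild coordinates `x̃⁰ = t`,
`x̃^i = x^i + M ω^i χ(r/(t+1)) ln r`. -/
def xt (M : ℝ) (χ : ℝ → ℝ) (a : Fin 4) : Spt → ℝ :=
  Fin.cases (fun p : Spt => p.1)
    (fun i => fun p : Spt =>
      p.2 i + M * (p.2 i / ‖p.2‖) * χ (‖p.2‖ / (p.1 + 1)) * Real.log ‖p.2‖) a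

/-- The Jacobian `A^a_α = ∂x̃^a/∂x^α`. -/
def Amat (M : ℝ) (χ : ℝ → ℝ) (p : Spt) : Matrix (Fin 4) (Fin 4) ℝ :=
  Matrix.of fun a α => pd α (xt M χ a) p

/-- The inverse Jacobian `A^α_a`. -/
def Ainv (M : ℝ) (χ : ℝ → ℝ) (p : Spt) : Matrix (Fin 4) (Fin 4) ℝ := (Amat M χ p)⁻¹

/-- The tilde coordinate functions as a vector. -/
def xtilde (M : ℝ) (χ : ℝ → ℝ) (p : Spt) (a : Fin 4) : ℝ := xt M χ a p

/-- `x̃_a` (indices lowered with the Minkowski metric). -/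
def xtlow (M : ℝ) (χ : ℝ → ℝ) (p : Spt) (a : Fin 4) : ℝ :=
  Fin.cases (-p.1) (fun i => xtilde M χ p i.succ) a

/-- The tangent vector of the tilde partial `∂̃_a = A^α_a ∂_α`. -/
def tdirVec (M : ℝ) (χ : ℝ → ℝ) (a : Fin 4) (p : Spt) : Spt :=
  toVec (fun α => Ainv M χ p α a)

/-- The tilde partial derivative `∂̃_a f`. -/
def tpd (M : ℝ) (χ : ℝ → ℝ) (a : Fin 4) (f : Spt → ℝ) (p : Spt) : ℝ :=
  fderiv ℝ f p (tdirVec M χ a p)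

/-- The modified vector fields `∂̃_a`, `Ω̃_{ab} = x̃_a∂̃_b - x̃_b∂̃_a`, `S̃ = x̃^a∂̃_a`
(as tangent-vector-valued maps). -/
def mfield (M : ℝ) (χ : ℝ → ℝ) : ZIdx → Spt → Spt
  | Sum.inl a => tdirVec M χ a
  | Sum.inr (Sum.inl ab) => fun p =>
      xtlow M χ p ab.1 • tdirVec M χ ab.2 p - xtlow M χ p ab.2 • tdirVec M χ ab.1 p
  | Sum.inr (Sum.inr _) => fun p => ∑ a : Fin 4, xtilde M χ p a • tdirVec M χ a p

/-- `X̃^I` applied to a scalar function. -/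
def xApply (M : ℝ) (χ : ℝ → ℝ) : {k : ℕ} → (Fin k → ZIdx) → (Spt → ℝ) → Spt → ℝ
  | 0, _, f => f
  | _+1, I, f => fun p => fderiv ℝ (xApply M χ (fun j => I j.succ) f) p (mfield M χ (I 0) p)

/-- `r* = r + M χ(r/(t+1)) ln r`. -/
def rstar (M : ℝ) (χ : ℝ → ℝ) (p : Spt) : ℝ :=
  ‖p.2‖ + M * χ (‖p.2‖ / (p.1 + 1)) * Real.log ‖p.2‖

def UU : Set Spt := {p | -(1/2:ℝ) < p.1 ∧ (p.1+1)/8 < ‖p.2‖}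

lemma UU_open : IsOpen UU := by
  apply IsOpen.inter
  · exact isOpen_lt continuous_const continuous_fst
  · exact isOpen_lt (f := fun p : Spt => (p.1+1)/8) (g := fun p : Spt => ‖p.2‖) (by fun_prop) (by fun_prop)

lemma UU_r {p : Spt} (hp : p ∈ UU) : 1/16 < ‖p.2‖ := by
  obtain ⟨h1, h2⟩ := hp
  linarith

def Sm (f : Spt → ℝ) : Prop := ContDiffOn ℝ (⊤:ℕ∞) f UU

def ap (V : Spt → Spt) (f : Spt → ℝ) (p : Spt) : ℝ := fderiv ℝ f p (V p)

lemma pd_eq_ap (a : Fin 4) (f : Spt → ℝ) : pd a f = ap (fun _ => dir a) f := rfl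

lemma Sm.diff {f : Spt → ℝ} (hf : Sm f) {p : Spt} (hp : p ∈ UU) : DifferentiableAt ℝ f p :=
  (hf.contDiffAt (UU_open.mem_nhds hp)).differentiableAt (by simp)

lemma Sm.ap {f : Spt → ℝ} (hf : Sm f) {V : Spt → Spt} (hV : ContDiffOn ℝ (⊤:ℕ∞) V UU) :
    Sm (ap V f) := by
  have : ContDiffOn ℝ (⊤:ℕ∞) (fderiv ℝ f) UU := hf.fderiv_of_isOpen UU_open (by simp)
  exact this.clm_apply hV

lemma Sm.pd {f : Spt → ℝ} (hf : Sm f) (a : Fin 4) : Sm (pd a f) :=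
  hf.ap contDiffOn_const

lemma Sm.add {f g : Spt → ℝ} (hf : Sm f) (hg : Sm g) : Sm (fun p => f p + g p) :=
  ContDiffOn.add hf hg
lemma Sm.mul {f g : Spt → ℝ} (hf : Sm f) (hg : Sm g) : Sm (fun p => f p * g p) :=
  ContDiffOn.mul hf hg
lemma Sm.const (c : ℝ) : Sm (fun _ => c) := contDiffOn_const
lemma Sm.congr {f g : Spt → ℝ} (hf : Sm f) (h : Set.EqOn f g UU) : Sm g :=
  ContDiffOn.congr hf (fun x hx => (h hx).symm)
lemma Sm.sum {ι : Type*} (s : Finset ι) {f : ι → Spt → ℝ} (hf : ∀ i ∈ s, Sm (f i)) :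
    Sm (fun p => ∑ i ∈ s, f i p) := ContDiffOn.sum hf

lemma ap_congr_open {O : Set Spt} (hO : IsOpen O) {f g : Spt → ℝ} {V V' : Spt → Spt}
    (h : Set.EqOn f g O) (hV : Set.EqOn V V' O) : Set.EqOn (ap V f) (ap V' g) O := by
  intro p hp
  have : f =ᶠ[nhds p] g := Filter.eventually_of_mem (hO.mem_nhds hp) h
  simp only [ap]
  rw [this.fderiv_eq, hV hp]

lemma ap_congr {f g : Spt → ℝ} (V : Spt → Spt)
    (h : Set.EqOn f g UU) : Set.EqOn (ap V f) (ap V g) UU :=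
  ap_congr_open UU_open h (fun _ _ => rfl)

lemma pd_congr {f g : Spt → ℝ} (a : Fin 4)
    (h : Set.EqOn f g UU) : Set.EqOn (pd a f) (pd a g) UU := ap_congr _ h

lemma ap_add {f g : Spt → ℝ} (hf : Sm f) (hg : Sm g) (V : Spt → Spt) :
    Set.EqOn (ap V (fun p => f p + g p)) (fun p => ap V f p + ap V g p) UU := by
  intro p hp
  simp only [ap]
  rw [fderiv_fun_add (hf.diff hp) (hg.diff hp)]; rfl

lemma ap_mul {f g : Spt → ℝ} (hf : Sm f) (hg : Sm g) (V : Spt → Spt) :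
    Set.EqOn (ap V (fun p => f p * g p)) (fun p => ap V f p * g p + f p * ap V g p) UU := by
  intro p hp
  simp only [ap]
  rw [fderiv_fun_mul (hf.diff hp) (hg.diff hp)]
  simp; ring

lemma ap_const_mul {f : Spt → ℝ} (c : ℝ) (hf : Sm f) (V : Spt → Spt) :
    Set.EqOn (ap V (fun p => c * f p)) (fun p => c * ap V f p) UU := by
  intro p hp
  simp only [ap]
  rw [fderiv_const_mul (hf.diff hp)]
  simp

lemma ap_sum {ι : Type*} (s : Finset ι) {f : ι → Spt → ℝ} (hf : ∀ i ∈ s, Sm (f i)) (V : Spt → Spt) :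
    Set.EqOn (ap V (fun p => ∑ i ∈ s, f i p)) (fun p => ∑ i ∈ s, ap V (f i) p) UU := by
  intro p hp
  simp only [ap]
  rw [fderiv_fun_sum (fun i hi => (hf i hi).diff hp)]
  simp

def coL (a : Fin 4) : Spt →L[ℝ] ℝ :=
  Fin.cases (ContinuousLinearMap.fst ℝ ℝ E3)
    (fun i => (EuclideanSpace.proj i).comp (ContinuousLinearMap.snd ℝ ℝ E3)) a

@[simp] lemma coL_zero (p : Spt) : coL 0 p = p.1 := rfl
@[simp] lemma coL_succ (i : Fin 3) (p : Spt) : coL i.succ p = p.2 i := rfl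

lemma xup_eq (p : Spt) (a : Fin 4) : xup p a = coL a p := by
  refine Fin.cases ?_ (fun i => ?_) a <;> rfl

lemma dir_zero : dir 0 = ((1:ℝ), (0:E3)) := rfl
lemma dir_succ (i : Fin 3) : dir i.succ = ((0:ℝ), EuclideanSpace.single i (1:ℝ)) := rfl

lemma coL_dir (a b : Fin 4) : coL a (dir b) = if a = b then 1 else 0 := by
  refine Fin.cases ?_ (fun i => ?_) a <;> refine Fin.cases ?_ (fun j => ?_) b
  · simp [dir_zero]
  · rw [dir_succ, coL_zero, if_neg (Fin.succ_ne_zero j).symm]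
  · simp [dir_zero]
  · simp [dir_succ, Fin.succ_inj, Pi.single_apply]

lemma coL_toVec (c : Fin 4 → ℝ) (a : Fin 4) : coL a (toVec c) = c a := by
  simp [toVec, coL_dir]

lemma ext_coL {v w : Spt} (h : ∀ a, coL a v = coL a w) : v = w := by
  refine Prod.ext (h 0) ?_
  ext i
  exact h i.succ

lemma toVec_coL (v : Spt) : toVec (fun a => coL a v) = v :=
  ext_coL fun a => coL_toVec _ a

lemma ap_eq_sum (V : Spt → Spt) (f : Spt → ℝ) (p : Spt) :
    ap V f p = ∑ a, coL a (V p) * pd a f p := by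
  simp only [ap]
  conv_lhs => rw [← toVec_coL (V p)]
  simp [toVec, pd]

/-! symbols -/

def SB (m : ℝ) (W f : ℝ → Spt → ℝ) : Prop :=
  ∃ C : ℝ, 0 ≤ C ∧ ∀ M, 0 ≤ M → M ≤ m → ∀ p ∈ UU, |f M p| ≤ C * W M p

def SymN (m : ℝ) : ℕ → (ℝ → Spt → ℝ) → (ℝ → Spt → ℝ) → Prop
  | 0, W, f => SB m W f
  | n+1, W, f => SB m W f ∧ ∀ a, SymN m n (fun M p => W M p / ‖p.2‖) (fun M => pd a (f M))

def FSm (m : ℝ) (f : ℝ → Spt → ℝ) : Prop := ∀ M, 0 ≤ M → M ≤ m → Sm (f M)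

def FEq (m : ℝ) (f g : ℝ → Spt → ℝ) : Prop := ∀ M, 0 ≤ M → M ≤ m → Set.EqOn (f M) (g M) UU

structure Sy (m : ℝ) (W f : ℝ → Spt → ℝ) : Prop where
  sm : FSm m f
  sy : ∀ n, SymN m n W f

lemma SymN.sb {m : ℝ} {n : ℕ} {W f : ℝ → Spt → ℝ} (h : SymN m n W f) : SB m W f := by
  cases n with
  | zero => exact h
  | succ n => exact h.1

lemma SymN.down {m : ℝ} {n : ℕ} {W f : ℝ → Spt → ℝ} (h : SymN m (n+1) W f) : SymN m n W f := by
  induction n generalizing W f with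
  | zero => exact h.1
  | succ n ih => exact ⟨h.1, fun a => ih (h.2 a)⟩

lemma SymN.congr {m : ℝ} {n : ℕ} {W f g : ℝ → Spt → ℝ} (h : SymN m n W f) (e : FEq m f g) :
    SymN m n W g := by
  have key : ∀ {W f g}, SB m W f → FEq m f g → SB m W g := by
    rintro W f g ⟨C, hC, h⟩ e
    exact ⟨C, hC, fun M h0 h1 p hp => by rw [← e M h0 h1 hp]; exact h M h0 h1 p hp⟩
  induction n generalizing W f g with
  | zero => exact key h e
  | succ n ih => exact ⟨key h.1 e, fun a => ih (h.2 a) (fun M h0 h1 => pd_congr a (e M h0 h1))⟩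

lemma SymN.mono {m : ℝ} {n : ℕ} {W W' f : ℝ → Spt → ℝ} (h : SymN m n W f) {K : ℝ} (hK : 0 ≤ K)
    (hW : ∀ M, 0 ≤ M → M ≤ m → ∀ p ∈ UU, W M p ≤ K * W' M p) :
    SymN m n W' f := by
  have key : ∀ {W W' f : ℝ → Spt → ℝ}, (∀ M, 0 ≤ M → M ≤ m → ∀ p ∈ UU, W M p ≤ K * W' M p) →
      SB m W f → SB m W' f := by
    rintro W W' f hW ⟨C, hC, h⟩
    refine ⟨C * K, by positivity, fun M h0 h1 p hp => (h M h0 h1 p hp).trans ?_⟩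
    rw [mul_assoc]
    exact mul_le_mul_of_nonneg_left (hW M h0 h1 p hp) hC
  induction n generalizing W W' f with
  | zero => exact key hW h
  | succ n ih =>
    refine ⟨key hW h.1, fun a => ih (h.2 a) ?_⟩
    intro M h0 h1 p hp
    have := UU_r hp
    rw [← mul_div_assoc]
    exact div_le_div_of_nonneg_right (hW M h0 h1 p hp) (by linarith)

lemma SymN.zero {m : ℝ} (n : ℕ) {W : ℝ → Spt → ℝ}
    (hW : ∀ M, 0 ≤ M → M ≤ m → ∀ p ∈ UU, 0 ≤ W M p) :
    SymN m n W (fun _ _ => 0) := by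
  induction n generalizing W with
  | zero => exact ⟨0, le_rfl, fun M h0 h1 p hp => by simp⟩
  | succ n ih =>
    refine ⟨⟨0, le_rfl, fun M h0 h1 p hp => by simp⟩, fun a => ?_⟩
    have := ih (W := fun M p => W M p / ‖p.2‖) (fun M h0 h1 p hp => by
      have := hW M h0 h1 p hp; positivity)
    convert this using 3
    simp [pd]

lemma SB.add {m : ℝ} {W f g : ℝ → Spt → ℝ} (hf : SB m W f) (hg : SB m W g) :
    SB m W (fun M p => f M p + g M p) := by
  obtain ⟨C, hC, hf⟩ := hf
  obtain ⟨D, hD, hg⟩ := hg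
  refine ⟨C + D, by positivity, fun M h0 h1 p hp => (abs_add_le _ _).trans ?_⟩
  have := hf M h0 h1 p hp
  have := hg M h0 h1 p hp
  linarith

lemma SB.mul {m : ℝ} {W W' f g : ℝ → Spt → ℝ} (hf : SB m W f) (hg : SB m W' g) :
    SB m (fun M p => W M p * W' M p) (fun M p => f M p * g M p) := by
  obtain ⟨C, hC, hf⟩ := hf
  obtain ⟨D, hD, hg⟩ := hg
  refine ⟨C * D, by positivity, fun M h0 h1 p hp => ?_⟩
  rw [abs_mul]
  have h1' := hf M h0 h1 p hp
  have h2' := hg M h0 h1 p hp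
  calc _ ≤ (C * W M p) * (D * W' M p) :=
        mul_le_mul h1' h2' (abs_nonneg _) ((abs_nonneg _).trans h1')
    _ = _ := by ring

lemma SymN.add {m : ℝ} {n : ℕ} {W f g : ℝ → Spt → ℝ} (hf : SymN m n W f) (hg : SymN m n W g)
    (sf : FSm m f) (sg : FSm m g) :
    SymN m n W (fun M p => f M p + g M p) := by
  induction n generalizing W f g with
  | zero => exact SB.add hf hg
  | succ n ih =>
    refine ⟨hf.1.add hg.1, fun a => ?_⟩
    exact (ih (hf.2 a) (hg.2 a) (fun M h0 h1 => (sf M h0 h1).pd a)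
      (fun M h0 h1 => (sg M h0 h1).pd a)).congr
      (fun M h0 h1 => (ap_add (sf M h0 h1) (sg M h0 h1) _).symm)

lemma SymN.mul {m : ℝ} {n : ℕ} {W W' f g : ℝ → Spt → ℝ} (hf : SymN m n W f) (hg : SymN m n W' g)
    (sf : FSm m f) (sg : FSm m g) :
    SymN m n (fun M p => W M p * W' M p) (fun M p => f M p * g M p) := by
  induction n generalizing W W' f g with
  | zero => exact SB.mul hf hg
  | succ n ih =>
    refine ⟨hf.1.mul hg.1, fun a => ?_⟩
    have spf : FSm m (fun M => pd a (f M)) := fun M h0 h1 => (sf M h0 h1).pd a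
    have spg : FSm m (fun M => pd a (g M)) := fun M h0 h1 => (sg M h0 h1).pd a
    have A := ih (hf.2 a) hg.down spf sg
    have B := ih hf.down (hg.2 a) sf spg
    have e1 : (fun M p => W M p / ‖p.2‖ * W' M p) =
      (fun (M : ℝ) (p : Spt) => W M p * W' M p / ‖p.2‖) := by funext M p; ring
    have e2 : (fun M p => W M p * (W' M p / ‖p.2‖)) =
      (fun (M : ℝ) (p : Spt) => W M p * W' M p / ‖p.2‖) := by funext M p; ring
    rw [e1] at A
    rw [e2] at B
    exact (A.add B (fun M h0 h1 => (spf M h0 h1).mul (sg M h0 h1))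
      (fun M h0 h1 => (sf M h0 h1).mul (spg M h0 h1))).congr
      (fun M h0 h1 => (ap_mul (sf M h0 h1) (sg M h0 h1) _).symm)

namespace Sy
variable {m : ℝ} {W W' f g : ℝ → Spt → ℝ}

lemma add (hf : Sy m W f) (hg : Sy m W g) : Sy m W (fun M p => f M p + g M p) :=
  ⟨fun M h0 h1 => (hf.sm M h0 h1).add (hg.sm M h0 h1),
   fun n => (hf.sy n).add (hg.sy n) hf.sm hg.sm⟩

lemma mul (hf : Sy m W f) (hg : Sy m W' g) :
    Sy m (fun M p => W M p * W' M p) (fun M p => f M p * g M p) :=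
  ⟨fun M h0 h1 => (hf.sm M h0 h1).mul (hg.sm M h0 h1),
   fun n => (hf.sy n).mul (hg.sy n) hf.sm hg.sm⟩

lemma mono (hf : Sy m W f) {K : ℝ} (hK : 0 ≤ K)
    (hW : ∀ M, 0 ≤ M → M ≤ m → ∀ p ∈ UU, W M p ≤ K * W' M p) : Sy m W' f :=
  ⟨hf.sm, fun n => (hf.sy n).mono hK hW⟩

lemma congr (hf : Sy m W f) (e : FEq m f g) : Sy m W g :=
  ⟨fun M h0 h1 => (hf.sm M h0 h1).congr (e M h0 h1), fun n => (hf.sy n).congr e⟩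

lemma weq (hf : Sy m W f) (hW : ∀ M p, p ∈ UU → W M p = W' M p) : Sy m W' f :=
  hf.mono zero_le_one (fun M _ _ p hp => by rw [hW M p hp, one_mul])

lemma zero (hW : ∀ M, 0 ≤ M → M ≤ m → ∀ p ∈ UU, 0 ≤ W M p) : Sy m W (fun _ _ => 0) :=
  ⟨fun _ _ _ => Sm.const 0, fun n => SymN.zero n hW⟩

lemma of_pd (sm : FSm m f) (hb : SB m W f)
    (h : ∀ a, Sy m (fun M p => W M p / ‖p.2‖) (fun M => pd a (f M))) : Sy m W f :=
  ⟨sm, fun n => by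
    cases n with
    | zero => exact hb
    | succ n => exact ⟨hb, fun a => (h a).sy n⟩⟩

lemma of_step (sm : FSm m f) (hb : SB m W f)
    (h : ∀ n, SymN m n W f → ∀ a, SymN m n (fun M p => W M p / ‖p.2‖) (fun M => pd a (f M))) :
    Sy m W f :=
  ⟨sm, fun n => by
    induction n with
    | zero => exact hb
    | succ n ih => exact ⟨hb, fun a => h n ih a⟩⟩

lemma pd (hf : Sy m W f) (a : Fin 4) :
    Sy m (fun M p => W M p / ‖p.2‖) (fun M => pd a (f M)) :=
  ⟨fun M h0 h1 => (hf.sm M h0 h1).pd a, fun n => (hf.sy (n+1)).2 a⟩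

lemma const (c : ℝ → ℝ) (hW : SB m W (fun M _ => c M)) (hW' : ∀ M, 0 ≤ M → M ≤ m → ∀ p ∈ UU, 0 ≤ W M p) :
    Sy m W (fun M _ => c M) := by
  refine of_pd (fun _ _ _ => Sm.const _) hW (fun a => ?_)
  have := Sy.zero (m := m) (W := fun M p => W M p / ‖p.2‖) (fun M h0 h1 p hp => by
      have := hW' M h0 h1 p hp; positivity)
  convert this using 3
  simp [_root_.pd]

lemma const1 (c : ℝ) : Sy m (fun _ _ => 1) (fun _ _ => c) :=
  const (fun _ => c) ⟨|c|, abs_nonneg _, fun _ _ _ _ _ => by simp⟩ (fun _ _ _ _ _ => zero_le_one)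

lemma const_mul (c : ℝ) (hf : Sy m W f) : Sy m W (fun M p => c * f M p) :=
  ((const1 c).mul hf).weq (fun M p _ => one_mul _)

lemma neg (hf : Sy m W f) : Sy m W (fun M p => - f M p) :=
  (hf.const_mul (-1)).congr (fun M _ _ p _ => by simp)

lemma sub (hf : Sy m W f) (hg : Sy m W g) : Sy m W (fun M p => f M p - g M p) :=
  (hf.add hg.neg).congr (fun M _ _ p _ => by simp [sub_eq_add_neg])

lemma sum {ι : Type*} (s : Finset ι) {f : ι → ℝ → Spt → ℝ} (hf : ∀ i ∈ s, Sy m W (f i))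
    (hW : ∀ M, 0 ≤ M → M ≤ m → ∀ p ∈ UU, 0 ≤ W M p) :
    Sy m W (fun M p => ∑ i ∈ s, f i M p) := by
  classical
  induction s using Finset.induction_on with
  | empty => simpa using Sy.zero hW
  | insert i s hi ih =>
    refine ((hf i (by simp)).add (ih fun j hj => hf j (by simp [hj]))).congr ?_
    intro M _ _ p _
    simp [Finset.sum_insert hi]

lemma prod1 {ι : Type*} (s : Finset ι) {f : ι → ℝ → Spt → ℝ}
    (hf : ∀ i ∈ s, Sy m (fun _ _ => 1) (f i)) :
    Sy m (fun _ _ => 1) (fun M p => ∏ i ∈ s, f i M p) := by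
  classical
  induction s using Finset.induction_on with
  | empty => simpa using const1 1
  | insert i s hi ih =>
    refine (((hf i (by simp)).mul (ih fun j hj => hf j (by simp [hj]))).weq
      (fun M p _ => one_mul _)).congr ?_
    intro M _ _ p _
    simp [Finset.prod_insert hi]

lemma shrink {m' : ℝ} (hf : Sy m W f) (hm : m' ≤ m) : Sy m' W f := by
  have key : ∀ n W f, SymN m n W f → SymN m' n W f := by
    have kb : ∀ W f, SB m W f → SB m' W f := fun W f ⟨C, hC, h⟩ =>
      ⟨C, hC, fun M h0 h1 => h M h0 (h1.trans hm)⟩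
    intro n
    induction n with
    | zero => exact kb
    | succ n ih => exact fun W f h => ⟨kb _ _ h.1, fun a => ih _ _ (h.2 a)⟩
  exact ⟨fun M h0 h1 => hf.sm M h0 (h1.trans hm), fun n => key n _ _ (hf.sy n)⟩

lemma comp {m' : ℝ} {κ : ℝ → ℝ} (hκ : ∀ M, 0 ≤ M → M ≤ m' → 0 ≤ κ M ∧ κ M ≤ m) (hf : Sy m W f) :
    Sy m' (fun M => W (κ M)) (fun M => f (κ M)) := by
  have key : ∀ n W f, SymN m n W f → SymN m' n (fun M => W (κ M)) (fun M => f (κ M)) := by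
    have kb : ∀ W f, SB m W f → SB m' (fun M => W (κ M)) (fun M => f (κ M)) := fun W f ⟨C, hC, h⟩ =>
      ⟨C, hC, fun M h0 h1 => h _ (hκ M h0 h1).1 (hκ M h0 h1).2⟩
    intro n
    induction n with
    | zero => exact kb
    | succ n ih => exact fun W f h => ⟨kb _ _ h.1, fun a => ih _ _ (h.2 a)⟩
  exact ⟨fun M h0 h1 => hf.sm _ (hκ M h0 h1).1 (hκ M h0 h1).2, fun n => key n _ _ (hf.sy n)⟩

end Sy

lemma Sm_of {f : Spt → ℝ} (hf : ContDiff ℝ (⊤:ℕ∞) f) : Sm f := hf.contDiffOn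

lemma pd_coL (a b : Fin 4) : pd b (fun p => coL a p) = fun _ => if a = b then 1 else 0 := by
  funext p
  simp only [pd]
  rw [show (fun p => coL a p) = ⇑(coL a) from rfl, ContinuousLinearMap.fderiv, coL_dir]

lemma abs_coL_le {p : Spt} (hp : p ∈ UU) (a : Fin 4) : |coL a p| ≤ 24 * ‖p.2‖ := by
  refine Fin.cases ?_ (fun i => ?_) a
  · obtain ⟨h1, h2⟩ := hp
    rw [coL_zero, abs_le]
    constructor <;> linarith
  · rw [coL_succ]
    have := PiLp.norm_apply_le p.2 i
    rw [Real.norm_eq_abs] at this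
    linarith [norm_nonneg p.2]

def sR : ℝ → Spt → ℝ := fun _ p => ‖p.2‖
def sO : ℝ → Spt → ℝ := fun _ _ => 1
def sI : ℝ → Spt → ℝ := fun _ p => ‖p.2‖⁻¹
def lam (p : Spt) : ℝ := 1 + Real.log (1 + ‖p.2‖)
def sL : ℝ → Spt → ℝ := fun _ p => lam p

lemma lam_ge {p : Spt} : 1 ≤ lam p := by
  have : 0 ≤ Real.log (1 + ‖p.2‖) := Real.log_nonneg (by linarith [norm_nonneg p.2])
  simp only [lam]; linarith

lemma lam_le {p : Spt} (hp : p ∈ UU) : lam p ≤ 17 * ‖p.2‖ := by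
  have h := UU_r hp
  have : Real.log (1 + ‖p.2‖) ≤ (1 + ‖p.2‖) - 1 := Real.log_le_sub_one_of_pos (by linarith)
  simp only [lam]; linarith

lemma Sy_coL (m : ℝ) (a : Fin 4) : Sy m sR (fun _ p => coL a p) := by
  refine Sy.of_pd (fun _ _ _ => Sm_of (coL a).contDiff) ⟨24, by norm_num, fun _ _ _ p hp => abs_coL_le hp a⟩ ?_
  intro b
  rw [pd_coL]
  refine (Sy.const1 _).weq (fun M p hp => ?_)
  have := UU_r hp
  exact (div_self (by positivity)).symm

def sp (a : Fin 4) (p : Spt) : ℝ := if a = 0 then 0 else coL a p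

lemma Sy_sp (m : ℝ) (a : Fin 4) : Sy m sR (fun _ p => sp a p) := by
  by_cases h : a = 0
  · simp only [sp, h, if_true]
    exact Sy.zero (fun _ _ _ p _ => norm_nonneg _)
  · simp only [sp, h, if_false]
    exact Sy_coL m a

lemma hasF_sq (p : Spt) : HasFDerivAt (fun q : Spt => ‖q.2‖^2)
    ((2 • (innerSL ℝ p.2)).comp (ContinuousLinearMap.snd ℝ ℝ E3)) p := by
  have h1 : HasFDerivAt (fun x : E3 => ‖x‖^2) (2 • (innerSL ℝ p.2)) p.2 :=
    (hasStrictFDerivAt_norm_sq p.2).hasFDerivAt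
  exact h1.comp p hasFDerivAt_snd

lemma sq_dir (p : Spt) (a : Fin 4) :
    ((2 • (innerSL ℝ p.2)).comp (ContinuousLinearMap.snd ℝ ℝ E3)) (dir a) = 2 * sp a p := by
  refine Fin.cases ?_ (fun i => ?_) a
  · simp [sp, dir_zero]
  · simp [sp, dir_succ, EuclideanSpace.inner_single_right]

lemma pd_comp_sq {F : ℝ → ℝ} {F' : ℝ} (p : Spt) (a : Fin 4) (h : HasDerivAt F F' (‖p.2‖^2)) :
    pd a (fun q => F (‖q.2‖^2)) p = F' * (2 * sp a p) := by
  simp only [pd]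
  rw [show (fun q : Spt => F (‖q.2‖^2)) = F ∘ (fun q : Spt => ‖q.2‖^2) from rfl,
    (h.comp_hasFDerivAt p (hasF_sq p)).fderiv, ContinuousLinearMap.smul_apply, sq_dir]
  rfl

lemma Sm_norm : Sm (fun p => ‖p.2‖) := by
  intro p hp
  have := UU_r hp
  have h0 : p.2 ≠ 0 := by intro h; rw [h, norm_zero] at this; linarith
  exact (contDiffAt_snd.norm ℝ h0).contDiffWithinAt

lemma pd_rinv {p : Spt} (hp : p ∈ UU) (a : Fin 4) :
    pd a (fun q => ‖q.2‖⁻¹) p = (-1) * (sp a p * (‖p.2‖⁻¹ * (‖p.2‖⁻¹ * ‖p.2‖⁻¹))) := by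
  have h := UU_r hp
  have e : (fun q : Spt => ‖q.2‖⁻¹) = (fun q : Spt => (fun s => (Real.sqrt s)⁻¹) (‖q.2‖^2)) := by
    funext q; simp
  have hd := ((Real.hasDerivAt_sqrt (x := ‖p.2‖^2) (by positivity)).fun_inv
    (by rw [Real.sqrt_sq (norm_nonneg _)]; positivity))
  rw [e, pd_comp_sq p a hd, Real.sqrt_sq (norm_nonneg _)]
  have : ‖p.2‖ ≠ 0 := by positivity
  field_simp

lemma pd_log {p : Spt} (hp : p ∈ UU) (a : Fin 4) :
    pd a (fun q => Real.log ‖q.2‖) p = sp a p * (‖p.2‖⁻¹ * ‖p.2‖⁻¹) := by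
  have h := UU_r hp
  have e : (fun q : Spt => Real.log ‖q.2‖) = (fun q : Spt => (fun s => Real.log s / 2) (‖q.2‖^2)) := by
    funext q; simp
  have hd := (Real.hasDerivAt_log (x := ‖p.2‖^2) (by positivity)).div_const 2
  rw [e, pd_comp_sq p a hd]
  have : ‖p.2‖ ≠ 0 := by positivity
  field_simp

lemma Sm_rinv : Sm (fun p => ‖p.2‖⁻¹) :=
  ContDiffOn.inv Sm_norm (fun p hp => by have := UU_r hp; positivity)

lemma Sy_rinv (m : ℝ) : Sy m sI (fun _ p => ‖p.2‖⁻¹) := by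
  have fs : FSm m (fun _ p => ‖p.2‖⁻¹) := fun _ _ _ => Sm_rinv
  refine Sy.of_step fs ⟨1, zero_le_one, fun M _ _ p hp => ?_⟩ ?_
  · rw [abs_of_nonneg (by positivity), one_mul]; exact le_rfl
  · intro n h a
    have h2 := h.mul h fs fs
    have fs2 : FSm m (fun _ p => ‖p.2‖⁻¹ * ‖p.2‖⁻¹) := fun _ _ _ => Sm_rinv.mul Sm_rinv
    have h3 := h.mul h2 fs fs2
    have fs3 : FSm m (fun _ p => ‖p.2‖⁻¹ * (‖p.2‖⁻¹ * ‖p.2‖⁻¹)) :=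
      fun _ _ _ => Sm_rinv.mul (Sm_rinv.mul Sm_rinv)
    have h4 := ((Sy_sp m a).sy n).mul h3 (Sy_sp m a).sm fs3
    have fs4 : FSm m (fun _ p => sp a p * (‖p.2‖⁻¹ * (‖p.2‖⁻¹ * ‖p.2‖⁻¹))) :=
      fun M h0 h1 => ((Sy_sp m a).sm M h0 h1).mul (fs3 M h0 h1)
    have h5 := ((Sy.const1 (m := m) (-1)).sy n).mul h4 (Sy.const1 (m := m) (-1)).sm fs4
    refine (h5.mono zero_le_one ?_).congr ?_
    · intro M _ _ p hp
      have := UU_r hp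
      have : ‖p.2‖ ≠ 0 := by positivity
      simp only [sR, sI]
      field_simp
      exact le_rfl
    · intro M _ _ p hp
      exact (pd_rinv hp a).symm

lemma log_bd {p : Spt} (hp : p ∈ UU) : |Real.log ‖p.2‖| ≤ 15 * lam p := by
  have h := UU_r hp
  have h1 := lam_ge (p := p)
  have a1 : Real.log ‖p.2‖ ≤ Real.log (1 + ‖p.2‖) := Real.log_le_log (by linarith) (by linarith)
  have a2 : -15 ≤ Real.log ‖p.2‖ := by
    have : Real.log (‖p.2‖⁻¹) ≤ ‖p.2‖⁻¹ - 1 := Real.log_le_sub_one_of_pos (by positivity)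
    rw [Real.log_inv] at this
    have : ‖p.2‖⁻¹ ≤ 16 := by
      rw [inv_le_comm₀ (by linarith) (by norm_num)]; linarith
    linarith
  rw [abs_le]
  constructor
  · linarith
  · simp only [lam] at h1 ⊢; linarith

lemma Sy_log (m : ℝ) : Sy m sL (fun _ p => Real.log ‖p.2‖) := by
  refine Sy.of_pd (fun _ _ _ => ?_) ⟨15, by norm_num, fun M _ _ p hp => log_bd hp⟩ (fun a => ?_)
  · exact ContDiffOn.log Sm_norm (fun p hp => by have := UU_r hp; positivity)
  · refine (((Sy_sp m a).mul ((Sy_rinv m).mul (Sy_rinv m))).mono zero_le_one ?_).congr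
      (fun M _ _ p hp => (pd_log hp a).symm)
    intro M _ _ p hp
    have := UU_r hp
    have h : ‖p.2‖ ≠ 0 := by positivity
    simp only [sR, sI, sL]
    have e : ‖p.2‖ * (‖p.2‖⁻¹ * ‖p.2‖⁻¹) = 1 / ‖p.2‖ := by field_simp
    rw [e, one_mul]
    exact div_le_div_of_nonneg_right lam_ge (by positivity)

lemma pd_comp_fun {ψ : ℝ → ℝ} (hψ : ContDiff ℝ (⊤:ℕ∞) ψ) {u : Spt → ℝ} (hu : Sm u) {p : Spt} (hp : p ∈ UU)
    (a : Fin 4) : pd a (fun q => ψ (u q)) p = deriv ψ (u p) * pd a u p := by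
  have h1 : HasDerivAt ψ (deriv ψ (u p)) (u p) :=
    (hψ.differentiable (by simp) _).hasDerivAt
  simp only [pd]
  rw [show (fun q => ψ (u q)) = ψ ∘ u from rfl,
    (h1.comp_hasFDerivAt p (hu.diff hp).hasFDerivAt).fderiv]
  rfl

lemma Sy_comp {m : ℝ} {u : ℝ → Spt → ℝ} (hu : Sy m sO u) {ψ : ℝ → ℝ} (hψ : ContDiff ℝ (⊤:ℕ∞) ψ) :
    Sy m sO (fun M p => ψ (u M p)) := by
  have fs : ∀ {ψ : ℝ → ℝ}, ContDiff ℝ (⊤:ℕ∞) ψ → FSm m (fun M p => ψ (u M p)) :=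
    fun hψ M h0 h1 => hψ.comp_contDiffOn (hu.sm M h0 h1)
  have hb : ∀ {ψ : ℝ → ℝ}, ContDiff ℝ (⊤:ℕ∞) ψ → SB m sO (fun M p => ψ (u M p)) := by
    intro ψ hψ
    obtain ⟨C, hC, h⟩ := (hu.sy 0).sb
    obtain ⟨D, hD⟩ := (isCompact_Icc (a := -C) (b := C)).exists_bound_of_continuousOn
      hψ.continuous.continuousOn
    refine ⟨|D|, abs_nonneg _, fun M h0 h1 p hp => ?_⟩
    have := h M h0 h1 p hp
    simp only [sO, mul_one] at this ⊢
    exact (hD _ (abs_le.mp this)).trans (le_abs_self D)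
  refine ⟨fs hψ, fun n => ?_⟩
  induction n generalizing ψ with
  | zero => exact hb hψ
  | succ n ih =>
    refine ⟨hb hψ, fun a => ?_⟩
    have hd : ContDiff ℝ (⊤:ℕ∞) (deriv ψ) := by
      exact (contDiff_infty_iff_deriv.mp hψ).2
    have := (ih hd).mul ((hu.pd a).sy n) (fs hd) (hu.pd a).sm
    refine (this.mono zero_le_one ?_).congr ?_
    · intro M _ _ p _
      simp [sO]
    · intro M h0 h1 p hp
      exact (pd_comp_fun hψ (hu.sm M h0 h1) hp a).symm

/-- inversion -/
lemma Sy_inv {m : ℝ} {f : ℝ → Spt → ℝ} (hf : Sy m sO f) {c : ℝ} (hc : 0 < c)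
    (hb : ∀ M, 0 ≤ M → M ≤ m → ∀ p ∈ UU, c ≤ f M p) : Sy m sO (fun M p => (f M p)⁻¹) := by
  have fs : FSm m (fun M p => (f M p)⁻¹) := fun M h0 h1 =>
    ContDiffOn.inv (hf.sm M h0 h1) (fun p hp => (hc.trans_le (hb M h0 h1 p hp)).ne')
  refine Sy.of_step fs ⟨c⁻¹, by positivity, fun M h0 h1 p hp => ?_⟩ ?_
  · have := hb M h0 h1 p hp
    have h' : 0 < f M p := hc.trans_le this
    rw [abs_of_pos (by positivity)]
    simp only [sO, mul_one]
    exact inv_anti₀ hc this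
  · intro n h a
    have h2 := h.mul h fs fs
    have fs2 : FSm m (fun M p => (f M p)⁻¹ * (f M p)⁻¹) := fun M h0 h1 =>
      (fs M h0 h1).mul (fs M h0 h1)
    have h3 := ((hf.pd a).neg.sy n).mul h2 (hf.pd a).neg.sm fs2
    refine (h3.mono zero_le_one ?_).congr ?_
    · intro M _ _ p _
      simp [sO]
    · intro M h0 h1 p hp
      have hne : f M p ≠ 0 := (hc.trans_le (hb M h0 h1 p hp)).ne'
      simp only [pd]
      rw [show (fun p => (f M p)⁻¹) = (fun y : ℝ => y⁻¹) ∘ (f M) from rfl,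
        ((hasDerivAt_inv hne).comp_hasFDerivAt p ((hf.sm M h0 h1).diff hp).hasFDerivAt).fderiv]
      simp
      field_simp

def psi (χ : ℝ → ℝ) (u : ℝ) : ℝ := if u < 1 then 1 else χ (u⁻¹)

lemma psi_smooth {χ : ℝ → ℝ} (hχ : ContDiff ℝ (⊤:ℕ∞) χ) (hχ1 : ∀ s, (3:ℝ)/4 ≤ s → χ s = 1) :
    ContDiff ℝ (⊤:ℕ∞) (psi χ) := by
  rw [contDiff_iff_contDiffAt]
  intro u
  rcases lt_or_ge u (4/3) with h | h
  · have : psi χ =ᶠ[nhds u] fun _ => 1 := by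
      filter_upwards [isOpen_Iio.mem_nhds h] with v hv
      simp only [psi]
      split_ifs with h1
      · rfl
      · have hv' : v < 4/3 := hv
        apply hχ1
        rw [le_inv_comm₀ (by norm_num) (by linarith)]
        linarith
    exact contDiffAt_const.congr_of_eventuallyEq this
  · have h1 : (1:ℝ) < u := by linarith
    have : psi χ =ᶠ[nhds u] fun v => χ (v⁻¹) := by
      filter_upwards [isOpen_Ioi.mem_nhds h1] with v hv
      have hv' : 1 < v := hv
      simp only [psi]
      rw [if_neg (by linarith)]
    refine ContDiffAt.congr_of_eventuallyEq ?_ this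
    exact hχ.contDiffAt.comp u (contDiffAt_inv ℝ (by linarith))

lemma psi_eq {χ : ℝ → ℝ} (hχ1 : ∀ s, (3:ℝ)/4 ≤ s → χ s = 1) {p : Spt} (hp : p ∈ UU) :
    χ (‖p.2‖ / (p.1 + 1)) = psi χ ((coL 0 p + 1) * ‖p.2‖⁻¹) := by
  have h := UU_r hp
  have h1 := hp.1
  rw [coL_zero]
  simp only [psi]
  by_cases h2 : (p.1 + 1) * ‖p.2‖⁻¹ < 1
  · rw [if_pos h2]
    apply hχ1
    rw [← div_eq_mul_inv, div_lt_one (by linarith)] at h2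
    rw [le_div_iff₀ (by linarith)]
    linarith
  · rw [if_neg h2]
    congr 1
    rw [mul_inv, inv_inv, div_eq_mul_inv, mul_comm]

def hh (χ : ℝ → ℝ) (a : Fin 4) (p : Spt) : ℝ :=
  Fin.cases 0 (fun i => (p.2 i / ‖p.2‖) * χ (‖p.2‖ / (p.1 + 1)) * Real.log ‖p.2‖) a

lemma xt_eq (M : ℝ) (χ : ℝ → ℝ) (a : Fin 4) (p : Spt) : xt M χ a p = coL a p + M * hh χ a p := by
  refine Fin.cases ?_ (fun i => ?_) a
  · simp [xt, hh]
  · simp only [xt, hh, Fin.cases_succ, coL_succ]; ring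

lemma one_le_R {p : Spt} (hp : p ∈ UU) : 1 ≤ 16 * ‖p.2‖ := by
  have := UU_r hp; linarith

lemma Sy_chi {χ : ℝ → ℝ} (hχ : ContDiff ℝ (⊤:ℕ∞) χ) (hχ1 : ∀ s, (3:ℝ)/4 ≤ s → χ s = 1) (m : ℝ) :
    Sy m sO (fun _ p => χ (‖p.2‖ / (p.1 + 1))) := by
  have h1 : Sy m sR (fun _ p => coL 0 p + 1) :=
    (Sy_coL m 0).add ((Sy.const1 1).mono (K := 16) (by norm_num) (fun _ _ _ p hp => one_le_R hp))
  have h2 : Sy m sO (fun _ p => (coL 0 p + 1) * ‖p.2‖⁻¹) := by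
    refine (h1.mul (Sy_rinv m)).weq (fun M p hp => ?_)
    have := UU_r hp
    simp only [sR, sI, sO]
    exact mul_inv_cancel₀ (by positivity)
  exact (Sy_comp h2 (psi_smooth hχ hχ1)).congr (fun M _ _ p hp => (psi_eq hχ1 hp).symm)

lemma Sy_hh {χ : ℝ → ℝ} (hχ : ContDiff ℝ (⊤:ℕ∞) χ) (hχ1 : ∀ s, (3:ℝ)/4 ≤ s → χ s = 1) (m : ℝ)
    (a : Fin 4) : Sy m sL (fun _ p => hh χ a p) := by
  refine Fin.cases ?_ (fun i => ?_) a
  · exact Sy.zero (fun _ _ _ p _ => zero_le_one.trans lam_ge)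
  · have := (((Sy_coL m i.succ).mul (Sy_rinv m)).mul (Sy_chi hχ hχ1 m)).mul (Sy_log m)
    refine (this.weq ?_).congr ?_
    · intro M p hp
      have := UU_r hp
      simp only [sR, sI, sO, sL]
      rw [mul_inv_cancel₀ (by positivity)]; ring
    · intro M _ _ p _
      simp only [hh, Fin.cases_succ, coL_succ, div_eq_mul_inv]

def sM : ℝ → Spt → ℝ := fun M _ => M
def sML : ℝ → Spt → ℝ := fun M p => M * lam p
def sMI : ℝ → Spt → ℝ := fun M p => M * lam p / ‖p.2‖

lemma Sy_M (m : ℝ) : Sy m sM (fun M _ => M) :=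
  Sy.const (fun M => M) ⟨1, zero_le_one, fun M h0 _ p _ => by rw [abs_of_nonneg h0]; simp [sM]⟩
    (fun M h0 _ _ _ => h0)

section
variable {χ : ℝ → ℝ} (hχ : ContDiff ℝ (⊤:ℕ∞) χ) (hχ1 : ∀ s, (3:ℝ)/4 ≤ s → χ s = 1)
include hχ hχ1

lemma Sy_Mhh (m : ℝ) (a : Fin 4) : Sy m sML (fun M p => M * hh χ a p) :=
  (Sy_M m).mul (Sy_hh hχ hχ1 m a)

lemma Sy_xt {m : ℝ} (hm : m ≤ 1) (a : Fin 4) : Sy m sR (fun M => xt M χ a) := by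
  refine ((Sy_coL m a).add ((Sy_Mhh hχ hχ1 m a).mono (K := 17) (by norm_num) ?_)).congr
    (fun M _ _ p _ => (xt_eq M χ a p).symm)
  intro M h0 h1 p hp
  have := lam_le hp
  have := lam_ge (p := p)
  simp only [sML, sR]
  nlinarith

lemma Sy_A1 {m : ℝ} (hm : m ≤ 1) (a α : Fin 4) :
    Sy m sMI (fun M p => Amat M χ p a α - (1 : Matrix (Fin 4) (Fin 4) ℝ) a α) := by
  have h := (Sy_Mhh hχ hχ1 m a).pd α
  refine h.congr ?_
  intro M h0 h1 p hp
  have e : xt M χ a = fun p => coL a p + M * hh χ a p := by funext p; exact xt_eq M χ a p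
  have := ap_add (Sm_of (coL a).contDiff) ((Sy_Mhh hχ hχ1 m a).sm M h0 h1) (fun _ => dir α) hp
  simp only [Amat, Matrix.of_apply, e]
  have e2 : pd α (fun p => coL a p + M * hh χ a p) p =
      pd α (fun p => coL a p) p + pd α (fun p => M * hh χ a p) p := this
  rw [e2, pd_coL, Matrix.one_apply]
  ring

lemma sMI_le {m : ℝ} (hm : m ≤ 1) : ∀ M, 0 ≤ M → M ≤ m → ∀ p ∈ UU, sMI M p ≤ 17 * sO M p := by
  intro M h0 h1 p hp
  have h := UU_r hp
  have := lam_le hp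
  have := lam_ge (p := p)
  simp only [sMI, sO, mul_one]
  rw [div_le_iff₀ (by linarith)]
  nlinarith

lemma Sy_A {m : ℝ} (hm : m ≤ 1) (a α : Fin 4) :
    Sy m sO (fun M p => Amat M χ p a α) := by
  refine (((Sy_A1 hχ hχ1 hm a α).mono (by norm_num) (sMI_le hχ hχ1 hm)).add
    (Sy.const1 ((1 : Matrix (Fin 4) (Fin 4) ℝ) a α))).congr ?_
  intro M _ _ p _
  simp

end

lemma det_near : ∃ δ > 0, ∀ A : Matrix (Fin 4) (Fin 4) ℝ,
    (∀ i j, |A i j - (1 : Matrix (Fin 4) (Fin 4) ℝ) i j| < δ) → 1/2 ≤ A.det := by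
  have hc : Continuous (fun f : Fin 4 → Fin 4 → ℝ => (Matrix.of f).det) := by
    have : Continuous (fun f : Fin 4 → Fin 4 → ℝ => Matrix.of f) := continuous_id
    exact this.matrix_det
  have := (hc.tendsto (fun i j => (1 : Matrix (Fin 4) (Fin 4) ℝ) i j))
  rw [Metric.tendsto_nhds_nhds] at this
  obtain ⟨δ, hδ, h⟩ := this (1/2) (by norm_num)
  refine ⟨δ, hδ, fun A hA => ?_⟩
  have h1 := @h (fun i j => A i j) (by
    rw [dist_pi_lt_iff hδ]
    intro i
    rw [dist_pi_lt_iff hδ]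
    intro j
    exact hA i j)
  have e1 : (Matrix.of (fun i j => (1 : Matrix (Fin 4) (Fin 4) ℝ) i j)).det = 1 := Matrix.det_one
  have e2 : (Matrix.of (fun i j => A i j)).det = A.det := rfl
  rw [e1, e2, Real.dist_eq, abs_lt] at h1
  linarith [h1.1]

section
variable {χ : ℝ → ℝ} (hχ : ContDiff ℝ (⊤:ℕ∞) χ) (hχ1 : ∀ s, (3:ℝ)/4 ≤ s → χ s = 1)
include hχ hχ1

lemma exists_m : ∃ m : ℝ, 0 < m ∧ m ≤ 1/10000 ∧
    ∀ M, 0 ≤ M → M ≤ m → ∀ p ∈ UU, 1/2 ≤ (Amat M χ p).det := by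
  obtain ⟨δ, hδ, hd⟩ := det_near
  have h : ∀ a α, SB 1 sMI (fun M p => Amat M χ p a α - (1 : Matrix (Fin 4) (Fin 4) ℝ) a α) :=
    fun a α => ((Sy_A1 hχ hχ1 le_rfl a α).sy 0).sb
  choose C hC h using h
  set K := ∑ a, ∑ α, C a α with hK
  have hCK : ∀ a α, C a α ≤ K := by
    intro a α
    refine (Finset.single_le_sum (f := fun α => C a α) (fun i _ => hC a i) (Finset.mem_univ α)).trans ?_
    exact Finset.single_le_sum (f := fun a => ∑ α, C a α) (fun i _ => Finset.sum_nonneg fun j _ => hC i j)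
      (Finset.mem_univ a)
  have hK0 : 0 ≤ K := (hC 0 0).trans (hCK 0 0)
  refine ⟨min (1/10000) (δ / (17 * K + 1) / 2), by positivity, min_le_left _ _, ?_⟩
  intro M h0 h1 p hp
  have hM1 : M ≤ 1/10000 := h1.trans (min_le_left _ _)
  have hM2 : M ≤ δ / (17 * K + 1) / 2 := h1.trans (min_le_right _ _)
  apply hd
  intro i j
  refine (h i j M h0 (by linarith) p hp).trans_lt ?_
  have h3 : sMI M p ≤ 17 * M := by
    have := UU_r hp
    have := lam_le hp
    simp only [sMI]
    rw [div_le_iff₀ (by linarith)]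
    nlinarith
  have h4 : 0 ≤ sMI M p := by
    have := lam_ge (p := p)
    simp only [sMI]; positivity
  have hM3 : M * (17 * K + 1) ≤ δ / 2 := by
    have : M ≤ (δ / 2) / (17 * K + 1) := by rw [div_right_comm]; exact hM2
    rwa [le_div_iff₀ (by positivity)] at this
  calc C i j * sMI M p ≤ K * (17 * M) := mul_le_mul (hCK i j) h3 h4 hK0
    _ ≤ M * (17 * K + 1) := by nlinarith
    _ < δ := by linarith

variable {m : ℝ} (hm : m ≤ 1)
  (hdet : ∀ M, 0 ≤ M → M ≤ m → ∀ p ∈ UU, 1/2 ≤ (Amat M χ p).det)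
include hm hdet

omit hχ hχ1 hm in
lemma inv_mul_A {M : ℝ} (h0 : 0 ≤ M) (h1 : M ≤ m) {p : Spt} (hp : p ∈ UU) :
    Ainv M χ p * Amat M χ p = 1 ∧ Amat M χ p * Ainv M χ p = 1 := by
  have : IsUnit (Amat M χ p).det := by
    have := hdet M h0 h1 p hp
    exact (isUnit_iff_ne_zero.mpr (by linarith))
  exact ⟨Matrix.nonsing_inv_mul _ this, Matrix.mul_nonsing_inv _ this⟩

omit hdet in
lemma Sy_det_gen {B : ℝ → Spt → Matrix (Fin 4) (Fin 4) ℝ}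
    (hB : ∀ i j, Sy m sO (fun M p => B M p i j)) : Sy m sO (fun M p => (B M p).det) := by
  simp only [Matrix.det_apply']
  refine Sy.sum _ (fun σ _ => ?_) (fun _ _ _ _ _ => zero_le_one)
  exact (Sy.prod1 _ (fun i _ => hB _ _)).const_mul _

lemma Sy_Ainv (a b : Fin 4) : Sy m sO (fun M p => Ainv M χ p a b) := by
  have hd : Sy m sO (fun M p => ((Amat M χ p).det)⁻¹) :=
    Sy_inv (Sy_det_gen hχ hχ1 hm (Sy_A hχ hχ1 hm)) (by norm_num : (0:ℝ) < 1/2) hdet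
  have hadj : Sy m sO (fun M p => (Amat M χ p).adjugate a b) := by
    simp only [Matrix.adjugate_apply]
    refine Sy_det_gen hχ hχ1 hm (fun i j => ?_)
    by_cases h : i = b
    · subst h
      simp only [Matrix.updateRow_self]
      exact Sy.const1 _
    · simp only [Matrix.updateRow_ne h]
      exact Sy_A hχ hχ1 hm i j
  refine ((hd.mul hadj).weq (W' := sO) (fun M p _ => by simp [sO])).congr (fun M h0 h1 p hp => ?_)
  simp [Ainv, Matrix.inv_def]

lemma Sy_Ainv1 (a b : Fin 4) :
    Sy m sMI (fun M p => Ainv M χ p a b - (1 : Matrix (Fin 4) (Fin 4) ℝ) a b) := by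
  have := Sy.sum (m := m) (W := sMI) Finset.univ (f := fun c M p => Ainv M χ p a c *
    (Amat M χ p c b - (1 : Matrix (Fin 4) (Fin 4) ℝ) c b))
    (fun c _ => ((Sy_Ainv hχ hχ1 hm hdet a c).mul (Sy_A1 hχ hχ1 hm c b)).weq
      (fun M p _ => by simp [sO]))
    (fun M h0 _ p _ => by
      have := lam_ge (p := p)
      simp only [sMI]; positivity)
  refine this.neg.congr (fun M h0 h1 p hp => ?_)
  have e : Ainv M χ p * (Amat M χ p - 1) = 1 - Ainv M χ p := by
    rw [mul_sub, (inv_mul_A hdet h0 h1 hp).1, mul_one]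
  have e2 := congrFun (congrFun e a) b
  simp only [Matrix.mul_apply, Matrix.sub_apply] at e2
  simp only [e2]
  ring
end

abbrev Fnl : Type := ℝ → (Spt → ℝ) → Spt → ℝ

structure GB (m : ℝ) (B : Fnl) : Prop where
  nonneg : ∀ M, 0 ≤ M → M ≤ m → ∀ f, ∀ p ∈ UU, 0 ≤ B M f p
  congr : ∀ M, 0 ≤ M → M ≤ m → ∀ f g, Set.EqOn f g UU → ∀ p ∈ UU, B M f p = B M g p
  add : ∀ M, 0 ≤ M → M ≤ m → ∀ f g, Sm f → Sm g → ∀ p ∈ UU,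
    B M (fun q => f q + g q) p ≤ B M f p + B M g p
  leib : ∀ W f, Sy m W f → ∃ C, 0 ≤ C ∧ ∀ M, 0 ≤ M → M ≤ m → ∀ ψ, Sm ψ → ∀ p ∈ UU,
    B M (fun q => f M q * ψ q) p ≤ C * W M p * B M ψ p

def absF : Fnl := fun _ f p => |f p|

lemma GB_abs (m : ℝ) : GB m absF where
  nonneg := fun _ _ _ _ _ _ => abs_nonneg _
  congr := fun _ _ _ f g h p hp => by simp only [absF]; rw [h hp]
  add := fun _ _ _ f g _ _ p hp => abs_add_le _ _
  leib := fun W f hf => by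
    obtain ⟨C, hC, h⟩ := (hf.sy 0).sb
    refine ⟨C, hC, fun M h0 h1 ψ _ p hp => ?_⟩
    simp only [absF]
    rw [abs_mul]
    exact mul_le_mul_of_nonneg_right (h M h0 h1 p hp) (abs_nonneg _)

abbrev Flds (ι : Type) : Type := ℝ → ι → Spt → Spt

def VS {ι : Type} (m : ℝ) (X : Flds ι) : Prop := ∀ i a, Sy m sR (fun M p => coL a (X M i p))

def VSm {ι : Type} (m : ℝ) (X : Flds ι) : Prop :=
  ∀ M, 0 ≤ M → M ≤ m → ∀ i, ContDiffOn ℝ (⊤:ℕ∞) (X M i) UU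

lemma VSm_of {ι : Type} {m : ℝ} {X : Flds ι}
    (h : ∀ M, 0 ≤ M → M ≤ m → ∀ i a, Sm (fun p => coL a (X M i p))) : VSm m X := by
  intro M h0 h1 i
  have : X M i = fun p => ∑ a, coL a (X M i p) • dir a := by
    funext p
    conv_lhs => rw [← toVec_coL (X M i p)]
    rfl
  rw [this]
  exact ContDiffOn.sum (fun a _ => (h M h0 h1 i a).smul contDiffOn_const)

lemma VS.sm {ι : Type} {m : ℝ} {X : Flds ι} (h : VS m X) : VSm m X :=
  VSm_of fun M h0 h1 i a => (h i a).sm M h0 h1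

lemma Sy.ap {ι : Type} {m : ℝ} {X : Flds ι} (hX : VS m X) (i : ι) {W f : ℝ → Spt → ℝ}
    (hf : Sy m W f) : Sy m W (fun M => ap (X M i) (f M)) := by
  obtain ⟨C, hC, hb⟩ := (hf.sy 0).sb
  have : Sy m (fun M p => C * W M p) (fun M p => ∑ a, coL a (X M i p) * _root_.pd a (f M) p) := by
    refine Sy.sum _ (fun a _ => ?_) (fun M h0 h1 p hp => (abs_nonneg _).trans (hb M h0 h1 p hp))
    have h1 := (hX i a).mul (hf.pd a)
    have h2 : Sy m (fun M p => (C + 1)⁻¹ * (C * W M p) + (C+1)⁻¹ * W M p)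
        (fun M p => coL a (X M i p) * _root_.pd a (f M) p) := by
      refine h1.weq (fun M p hp => ?_)
      have := UU_r hp
      have : ‖p.2‖ ≠ 0 := by positivity
      simp only [sR]
      field_simp
    by_cases hC0 : C = 0
    · -- then f vanishes on the region
      have hz : ∀ M, 0 ≤ M → M ≤ m → Set.EqOn (f M) (fun _ => 0) UU := by
        intro M h0 h1 p hp
        have := hb M h0 h1 p hp
        rw [hC0, zero_mul] at this
        exact abs_nonpos_iff.mp this
      refine (Sy.zero (W := fun M p => C * W M p) (fun M h0 h1 p hp =>
        (abs_nonneg _).trans (hb M h0 h1 p hp))).congr ?_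
      intro M h0 h1 p hp
      have := pd_congr a (hz M h0 h1) hp
      simp only [this]
      simp [_root_.pd]
    · have hCp : 0 < C := lt_of_le_of_ne hC (Ne.symm hC0)
      refine h2.mono (K := 1 / C) (by positivity) ?_
      intro M h0 h1 p hp
      have : C ≠ 0 := hC0
      have : C + 1 ≠ 0 := by positivity
      apply le_of_eq
      field_simp
  exact (this.mono (K := C) hC (fun _ _ _ _ _ => le_rfl)).congr
    (fun M _ _ p _ => (ap_eq_sum _ _ _).symm)

section
variable {ι : Type} [Fintype ι]

def nrm (X : Flds ι) (B : Fnl) : ℕ → Fnl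
  | 0 => fun M f p => B M f p
  | k+1 => fun M f p => B M f p + ∑ i, nrm X B k M (ap (X M i) f) p

section
variable {m : ℝ} {X : Flds ι} {B : Fnl}

lemma GB_nrm (hX : VS m X) (hB : GB m B) (k : ℕ) : GB m (nrm X B k) := by
  induction k with
  | zero => exact hB
  | succ k ih =>
    refine ⟨?_, ?_, ?_, ?_⟩
    · intro M h0 h1 f p hp
      exact add_nonneg (hB.nonneg M h0 h1 f p hp)
        (Finset.sum_nonneg fun i _ => ih.nonneg M h0 h1 _ p hp)
    · intro M h0 h1 f g hfg p hp
      simp only [nrm]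
      rw [hB.congr M h0 h1 f g hfg p hp]
      congr 1
      exact Finset.sum_congr rfl fun i _ => ih.congr M h0 h1 _ _ (ap_congr _ hfg) p hp
    · intro M h0 h1 f g hf hg p hp
      simp only [nrm]
      have a1 := hB.add M h0 h1 f g hf hg p hp
      have a2 : ∑ i, nrm X B k M (ap (X M i) (fun q => f q + g q)) p ≤
          ∑ i, (nrm X B k M (ap (X M i) f) p + nrm X B k M (ap (X M i) g) p) := by
        refine Finset.sum_le_sum fun i _ => ?_
        rw [ih.congr M h0 h1 _ _ (ap_add hf hg _) p hp]
        exact ih.add M h0 h1 _ _ (hf.ap (hX.sm M h0 h1 i)) (hg.ap (hX.sm M h0 h1 i)) p hp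
      rw [Finset.sum_add_distrib] at a2
      linarith
    · intro W f hf
      obtain ⟨C0, hC0, h0'⟩ := hB.leib W f hf
      obtain ⟨C1, hC1, h1'⟩ := ih.leib W f hf
      choose C2 hC2 h2' using fun i => ih.leib W _ (hf.ap hX i)
      obtain ⟨Cf, hCf, hfb⟩ := (hf.sy 0).sb
      -- nrm k ≤ nrm (k+1) is built in via a separate monotonicity fact
      have mono : ∀ k M, 0 ≤ M → M ≤ m → ∀ f, ∀ p ∈ UU, (∀ g, 0 ≤ B M g p) →
          nrm X B k M f p ≤ nrm X B (k+1) M f p ∧ 0 ≤ nrm X B k M f p := by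
        intro k
        induction k with
        | zero =>
          intro M h0 h1 f p hp hb
          simp only [nrm]
          exact ⟨le_add_of_nonneg_right (Finset.sum_nonneg fun i _ => hb _), hb _⟩
        | succ k ihk =>
          intro M h0 h1 f p hp hb
          refine ⟨?_, ?_⟩
          · conv_lhs => rw [nrm]
            conv_rhs => rw [nrm]
            exact add_le_add_right (Finset.sum_le_sum fun i _ => (ihk M h0 h1 _ p hp hb).1) _
          · exact add_nonneg (hb _) (Finset.sum_nonneg fun i _ => (ihk M h0 h1 _ p hp hb).2)
      by_cases hCf0 : Cf = 0
      · -- f vanishes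
        refine ⟨0, le_rfl, fun M h0 h1 ψ hψ p hp => ?_⟩
        have hz : Set.EqOn (fun q => f M q * ψ q) (fun _ => 0) UU := by
          intro q hq
          have := hfb M h0 h1 q hq
          rw [hCf0, zero_mul] at this
          simp [abs_nonpos_iff.mp this]
        have zero_nrm : ∀ k, GB m (nrm X B k) → nrm X B k M (fun _ => 0) p ≤ 0 := by
          intro k hG
          obtain ⟨D, hD, hl⟩ := hG.leib (fun _ _ => 0) (fun _ _ => 0) (Sy.zero fun _ _ _ _ _ => le_rfl)
          have := hl M h0 h1 (fun _ => 0) (Sm.const 0) p hp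
          simpa using this
        have hz2 : ∀ i, Set.EqOn (ap (X M i) (fun q => f M q * ψ q)) (fun _ => 0) UU := by
          intro i q hq
          rw [ap_congr _ hz hq]; simp [ap]
        simp only [nrm, zero_mul]
        rw [hB.congr M h0 h1 _ _ hz p hp,
          Finset.sum_congr rfl fun i _ => ih.congr M h0 h1 _ _ (hz2 i) p hp]
        exact add_nonpos (zero_nrm 0 hB) (Finset.sum_nonpos fun i _ => zero_nrm k ih)
      · refine ⟨C0 + C1 + ∑ i, C2 i, add_nonneg (add_nonneg hC0 hC1) (Finset.sum_nonneg fun i _ => hC2 i),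
          fun M h0 h1 ψ hψ p hp => ?_⟩
        have hW : 0 ≤ W M p := by
          have := (abs_nonneg _).trans (hfb M h0 h1 p hp)
          exact nonneg_of_mul_nonneg_right this (lt_of_le_of_ne hCf (Ne.symm hCf0))
        have hfM := hf.sm M h0 h1
        have mk := (mono k M h0 h1 ψ p hp (fun g => hB.nonneg M h0 h1 g p hp)).1
        have step : ∀ i, nrm X B k M (ap (X M i) (fun q => f M q * ψ q)) p ≤
            C2 i * W M p * nrm X B (k+1) M ψ p + C1 * W M p * nrm X B k M (ap (X M i) ψ) p := by
          intro i
          rw [ih.congr M h0 h1 _ _ (ap_mul hfM hψ _) p hp]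
          refine (ih.add M h0 h1 _ _ ((hfM.ap (hX.sm M h0 h1 i)).mul hψ)
            (hfM.mul (hψ.ap (hX.sm M h0 h1 i))) p hp).trans ?_
          refine add_le_add ((h2' i M h0 h1 ψ hψ p hp).trans ?_)
            (h1' M h0 h1 _ (hψ.ap (hX.sm M h0 h1 i)) p hp)
          exact mul_le_mul_of_nonneg_left mk (mul_nonneg (hC2 i) hW)
        have a2 := Finset.sum_le_sum (fun i (_ : i ∈ Finset.univ) => step i)
        rw [Finset.sum_add_distrib, ← Finset.mul_sum, ← Finset.sum_mul, ← Finset.sum_mul] at a2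
        have a1 := h0' M h0 h1 ψ hψ p hp
        have b0 := hB.nonneg M h0 h1 ψ p hp
        have b1 : 0 ≤ ∑ i, nrm X B k M (ap (X M i) ψ) p :=
          Finset.sum_nonneg fun i _ => ih.nonneg M h0 h1 _ p hp
        have e : nrm X B (k+1) M ψ p = B M ψ p + ∑ i, nrm X B k M (ap (X M i) ψ) p := rfl
        have e' : nrm X B (k+1) M (fun q => f M q * ψ q) p = B M (fun q => f M q * ψ q) p
          + ∑ i, nrm X B k M (ap (X M i) (fun q => f M q * ψ q)) p := rfl
        rw [e']
        have t1 : C0 * W M p * B M ψ p ≤ C0 * W M p * nrm X B (k+1) M ψ p :=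
          mul_le_mul_of_nonneg_left (by linarith) (mul_nonneg hC0 hW)
        have t2 : C1 * W M p * ∑ i, nrm X B k M (ap (X M i) ψ) p ≤ C1 * W M p * nrm X B (k+1) M ψ p :=
          mul_le_mul_of_nonneg_left (by linarith) (mul_nonneg hC1 hW)
        calc _ ≤ _ := add_le_add a1 a2
          _ ≤ _ := by nlinarith

lemma nrm_mono (hB : GB m B) (k : ℕ) {M : ℝ} (h0 : 0 ≤ M) (h1 : M ≤ m) (f : Spt → ℝ) {p : Spt}
    (hp : p ∈ UU) : nrm X B k M f p ≤ nrm X B (k+1) M f p ∧ 0 ≤ nrm X B k M f p := by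
  induction k generalizing f with
  | zero =>
    simp only [nrm]
    exact ⟨le_add_of_nonneg_right (Finset.sum_nonneg fun i _ => hB.nonneg M h0 h1 _ p hp),
      hB.nonneg M h0 h1 _ p hp⟩
  | succ k ihk =>
    refine ⟨?_, ?_⟩
    · conv_lhs => rw [nrm]
      conv_rhs => rw [nrm]
      exact add_le_add_right (Finset.sum_le_sum fun i _ => (ihk _).1) _
    · exact add_nonneg (hB.nonneg M h0 h1 _ p hp) (Finset.sum_nonneg fun i _ => (ihk _).2)

lemma nrm_sub (hB : GB m B) (k : ℕ) {M : ℝ} (h0 : 0 ≤ M) (h1 : M ≤ m) (f : Spt → ℝ) {p : Spt}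
    (hp : p ∈ UU) : B M f p ≤ nrm X B (k+1) M f p ∧
      ∀ i, nrm X B k M (ap (X M i) f) p ≤ nrm X B (k+1) M f p := by
  have hs : ∀ i, 0 ≤ nrm X B k M (ap (X M i) f) p := fun i => (nrm_mono hB k h0 h1 _ hp).2
  have e : nrm X B (k+1) M f p = B M f p + ∑ i, nrm X B k M (ap (X M i) f) p := rfl
  rw [e]
  refine ⟨le_add_of_nonneg_right (Finset.sum_nonneg fun i _ => hs i), fun i => ?_⟩
  have := Finset.single_le_sum (f := fun i => nrm X B k M (ap (X M i) f) p) (fun i _ => hs i)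
    (Finset.mem_univ i)
  have := hB.nonneg M h0 h1 f p hp
  linarith
end

section
variable {m : ℝ} {X Y : Flds ι} {D : Flds (Fin 4)} {B : Fnl}

lemma GB.sum {κ : Type} (hB : GB m B) (s : Finset κ) {M : ℝ} (h0 : 0 ≤ M) (h1 : M ≤ m)
    {f : κ → Spt → ℝ} (hf : ∀ i ∈ s, Sm (f i)) {p : Spt} (hp : p ∈ UU) :
    B M (fun q => ∑ i ∈ s, f i q) p ≤ ∑ i ∈ s, B M (f i) p := by
  classical
  induction s using Finset.induction_on with
  | empty =>
    obtain ⟨D, hD, hl⟩ := hB.leib (fun _ _ => 0) (fun _ _ => 0) (Sy.zero fun _ _ _ _ _ => le_rfl)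
    have := hl M h0 h1 (fun _ => 0) (Sm.const 0) p hp
    simpa using this
  | insert i s hi ih =>
    simp only [Finset.sum_insert hi]
    refine (hB.add M h0 h1 _ _ (hf i (by simp)) (Sm.sum s fun j hj => hf j (by simp [hj])) p hp).trans ?_
    have := ih fun j hj => hf j (by simp [hj])
    linarith

lemma GB.csmul (hB : GB m B) (c : ℝ) : ∃ C, 0 ≤ C ∧ ∀ M, 0 ≤ M → M ≤ m → ∀ ψ, Sm ψ → ∀ p ∈ UU,
    B M (fun q => c * ψ q) p ≤ C * B M ψ p := by
  obtain ⟨C, hC, h⟩ := hB.leib _ _ (Sy.const1 (m := m) c)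
  exact ⟨C, hC, fun M h0 h1 ψ hψ p hp => by simpa using h M h0 h1 ψ hψ p hp⟩

def Comm (m : ℝ) (X : Flds ι) (D : Flds (Fin 4)) (c : ι → Fin 4 → Fin 4 → ℝ) : Prop :=
  ∀ M, 0 ≤ M → M ≤ m → ∀ ψ, Sm ψ → ∀ i a, Set.EqOn (ap (X M i) (ap (D M a) ψ))
    (fun p => ap (D M a) (ap (X M i) ψ) p + ∑ b, c i a b * ap (D M b) ψ p) UU

def BD (D : Flds (Fin 4)) (B : Fnl) : Fnl := fun M f p => ∑ c, B M (ap (D M c) f) p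

lemma com_Q (hX : VS m X) (hD : VSm m D) (hB : GB m B) {c : ι → Fin 4 → Fin 4 → ℝ}
    (hc : Comm m X D c) (k : ℕ) : ∃ C, 0 ≤ C ∧ ∀ M, 0 ≤ M → M ≤ m → ∀ ψ, Sm ψ → ∀ a, ∀ p ∈ UU,
      nrm X B k M (ap (D M a) ψ) p ≤ C * nrm X (BD D B) k M ψ p := by
  have hBD0 : ∀ M, 0 ≤ M → M ≤ m → ∀ f, ∀ p ∈ UU, 0 ≤ BD D B M f p := fun M h0 h1 f p hp =>
    Finset.sum_nonneg fun i _ => hB.nonneg M h0 h1 _ p hp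
  have hN0 : ∀ k M, 0 ≤ M → M ≤ m → ∀ f, ∀ p ∈ UU, 0 ≤ nrm X (BD D B) k M f p ∧
      nrm X (BD D B) k M f p ≤ nrm X (BD D B) (k+1) M f p := by
    intro k
    induction k with
    | zero =>
      intro M h0 h1 f p hp
      exact ⟨hBD0 M h0 h1 f p hp, le_add_of_nonneg_right (Finset.sum_nonneg fun i _ => hBD0 M h0 h1 _ p hp)⟩
    | succ k ih =>
      intro M h0 h1 f p hp
      refine ⟨add_nonneg (hBD0 M h0 h1 f p hp) (Finset.sum_nonneg fun i _ => (ih M h0 h1 _ p hp).1), ?_⟩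
      conv_lhs => rw [nrm]
      conv_rhs => rw [nrm]
      exact add_le_add_right (Finset.sum_le_sum fun i _ => (ih M h0 h1 _ p hp).2) _
  have hsing : ∀ M, 0 ≤ M → M ≤ m → ∀ ψ a, ∀ p ∈ UU, B M (ap (D M a) ψ) p ≤ BD D B M ψ p := by
    intro M h0 h1 ψ a p hp
    exact Finset.single_le_sum (f := fun a => B M (ap (D M a) ψ) p)
      (fun i _ => hB.nonneg M h0 h1 _ p hp) (Finset.mem_univ a)
  induction k with
  | zero =>
    refine ⟨1, zero_le_one, fun M h0 h1 ψ hψ a p hp => ?_⟩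
    rw [one_mul]
    exact hsing M h0 h1 ψ a p hp
  | succ k ih =>
    obtain ⟨C, hC, ih⟩ := ih
    have hG := GB_nrm hX hB k
    choose K hK hK' using fun i a b => hG.csmul (c i a b)
    set T := ∑ i, ∑ a, ∑ b, K i a b with hT
    have hT0 : 0 ≤ T := Finset.sum_nonneg fun i _ => Finset.sum_nonneg fun a _ =>
      Finset.sum_nonneg fun b _ => hK i a b
    refine ⟨1 + C + T * C, by positivity, fun M h0 h1 ψ hψ a p hp => ?_⟩
    have step : ∀ i, nrm X B k M (ap (X M i) (ap (D M a) ψ)) p ≤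
        C * nrm X (BD D B) k M (ap (X M i) ψ) p + (∑ b, K i a b) * (C * nrm X (BD D B) k M ψ p) := by
      intro i
      have sD : ∀ b, Sm (ap (D M b) ψ) := fun b => hψ.ap (hD M h0 h1 b)
      have sX : Sm (ap (X M i) ψ) := hψ.ap (hX.sm M h0 h1 i)
      have sc : ∀ b, Sm (fun p => c i a b * ap (D M b) ψ p) := fun b => (Sm.const _).mul (sD b)
      rw [hG.congr M h0 h1 _ _ (hc M h0 h1 ψ hψ i a) p hp]
      refine (hG.add M h0 h1 _ _ (sX.ap (hD M h0 h1 a)) (Sm.sum _ fun b _ => sc b) p hp).trans ?_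
      refine add_le_add (ih M h0 h1 _ sX a p hp) ?_
      refine (hG.sum _ h0 h1 (fun b _ => sc b) hp).trans ?_
      rw [Finset.sum_mul]
      refine Finset.sum_le_sum fun b _ => ?_
      refine (hK' i a b M h0 h1 _ (sD b) p hp).trans ?_
      exact mul_le_mul_of_nonneg_left (ih M h0 h1 ψ hψ b p hp) (hK i a b)
    have s2 := Finset.sum_le_sum (fun i (_ : i ∈ Finset.univ) => step i)
    rw [Finset.sum_add_distrib, ← Finset.mul_sum, ← Finset.sum_mul] at s2
    have hTa : ∑ i, ∑ b, K i a b ≤ T := by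
      refine Finset.sum_le_sum fun i _ => ?_
      exact Finset.single_le_sum (f := fun a => ∑ b, K i a b)
        (fun a _ => Finset.sum_nonneg fun b _ => hK i a b) (Finset.mem_univ a)
    have n0 := hN0 k M h0 h1 ψ p hp
    have e : nrm X (BD D B) (k+1) M ψ p = BD D B M ψ p + ∑ i, nrm X (BD D B) k M (ap (X M i) ψ) p := rfl
    have b0 := hBD0 M h0 h1 ψ p hp
    have b1 : 0 ≤ ∑ i, nrm X (BD D B) k M (ap (X M i) ψ) p :=
      Finset.sum_nonneg fun i _ => (hN0 k M h0 h1 _ p hp).1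
    have e' : nrm X B (k+1) M (ap (D M a) ψ) p = B M (ap (D M a) ψ) p +
      ∑ i, nrm X B k M (ap (X M i) (ap (D M a) ψ)) p := rfl
    have t1 := hsing M h0 h1 ψ a p hp
    have t2 : (∑ i, ∑ b, K i a b) * (C * nrm X (BD D B) k M ψ p) ≤
        T * (C * nrm X (BD D B) (k+1) M ψ p) :=
      mul_le_mul hTa (mul_le_mul_of_nonneg_left n0.2 hC) (mul_nonneg hC n0.1) hT0
    have t3 : C * ∑ i, nrm X (BD D B) k M (ap (X M i) ψ) p ≤ C * nrm X (BD D B) (k+1) M ψ p :=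
      mul_le_mul_of_nonneg_left (by linarith) hC
    rw [e']
    calc _ ≤ _ := add_le_add t1 s2
      _ ≤ nrm X (BD D B) (k+1) M ψ p + (C * nrm X (BD D B) (k+1) M ψ p +
          T * (C * nrm X (BD D B) (k+1) M ψ p)) := by
          refine add_le_add (by linarith) (add_le_add t3 t2)
      _ = _ := by ring

lemma com_w (hX : VS m X) (hD : VSm m D) (hB : GB m B) {c : ι → Fin 4 → Fin 4 → ℝ}
    (hc : Comm m X D c) {w : ℝ → Spt → ℝ} (hw0 : ∀ M p, 0 ≤ w M p)
    (hw : ∃ C, 0 ≤ C ∧ ∀ M, 0 ≤ M → M ≤ m → ∀ ψ, Sm ψ → ∀ p ∈ UU, 0 ≤ p.1 → ∀ a,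
      w M p * B M (ap (D M a) ψ) p ≤ C * nrm X B 1 M ψ p) (k : ℕ) :
    ∃ C, 0 ≤ C ∧ ∀ M, 0 ≤ M → M ≤ m → ∀ ψ, Sm ψ → ∀ p ∈ UU, 0 ≤ p.1 → ∀ a,
      w M p * nrm X B k M (ap (D M a) ψ) p ≤ C * nrm X B (k+1) M ψ p := by
  obtain ⟨C0, hC0, h0'⟩ := hw
  have key : ∃ C, 0 ≤ C ∧ ∀ M, 0 ≤ M → M ≤ m → ∀ ψ, Sm ψ → ∀ p ∈ UU, 0 ≤ p.1 →
      w M p * nrm X (BD D B) k M ψ p ≤ C * nrm X B (k+1) M ψ p := by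
    have base : ∀ M, 0 ≤ M → M ≤ m → ∀ ψ, Sm ψ → ∀ p ∈ UU, 0 ≤ p.1 →
        w M p * BD D B M ψ p ≤ (4 * C0) * nrm X B 1 M ψ p := by
      intro M h0 h1 ψ hψ p hp ht
      simp only [BD]
      rw [Finset.mul_sum]
      refine (Finset.sum_le_sum fun a _ => h0' M h0 h1 ψ hψ p hp ht a).trans ?_
      simp
      linarith
    induction k with
    | zero => exact ⟨4 * C0, by positivity, base⟩
    | succ k ih =>
      obtain ⟨C, hC, ih⟩ := ih
      refine ⟨4 * C0 + C, by positivity, fun M h0 h1 ψ hψ p hp ht => ?_⟩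
      have t1 := base M h0 h1 ψ hψ p hp ht
      have e : nrm X (BD D B) (k+1) M ψ p = BD D B M ψ p +
        ∑ i, nrm X (BD D B) k M (ap (X M i) ψ) p := rfl
      rw [e, mul_add]
      have t2 := Finset.sum_le_sum (fun i (_ : i ∈ Finset.univ) =>
        ih M h0 h1 (ap (X M i) ψ) (hψ.ap (hX.sm M h0 h1 i)) p hp ht)
      rw [← Finset.mul_sum, ← Finset.mul_sum] at t2
      have e2 : nrm X B (k+2) M ψ p = B M ψ p + ∑ i, nrm X B (k+1) M (ap (X M i) ψ) p := rfl
      have b0 := hB.nonneg M h0 h1 ψ p hp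
      have m1 : nrm X B 1 M ψ p ≤ nrm X B (k+2) M ψ p := by
        have : ∀ j, nrm X B 1 M ψ p ≤ nrm X B (j+1) M ψ p := by
          intro j
          induction j with
          | zero => exact le_rfl
          | succ j ihj => exact ihj.trans (nrm_mono hB (j+1) h0 h1 ψ hp).1
        exact this (k+1)
      have t3 : C * ∑ i, nrm X B (k+1) M (ap (X M i) ψ) p ≤ C * nrm X B (k+2) M ψ p :=
        mul_le_mul_of_nonneg_left (by linarith) hC
      have t4 : (4 * C0) * nrm X B 1 M ψ p ≤ (4 * C0) * nrm X B (k+2) M ψ p :=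
        mul_le_mul_of_nonneg_left m1 (by positivity)
      rw [add_mul]
      exact add_le_add (t1.trans t4) (t2.trans t3)
  obtain ⟨C, hC, key⟩ := key
  obtain ⟨C', hC', hQ⟩ := com_Q hX hD hB hc k
  refine ⟨C' * C, by positivity, fun M h0 h1 ψ hψ p hp ht a => ?_⟩
  calc _ ≤ w M p * (C' * nrm X (BD D B) k M ψ p) :=
        mul_le_mul_of_nonneg_left (hQ M h0 h1 ψ hψ a p hp) (hw0 M p)
    _ = C' * (w M p * nrm X (BD D B) k M ψ p) := by ring
    _ ≤ C' * (C * nrm X B (k+1) M ψ p) := mul_le_mul_of_nonneg_left (key M h0 h1 ψ hψ p hp ht) hC'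
    _ = _ := by ring

lemma main_cmp (hX : VS m X) (hY : VS m Y) (hD : VSm m D) (hB : GB m B)
    {c : ι → Fin 4 → Fin 4 → ℝ}
    (hc : Comm m X D c) {w : ℝ → Spt → ℝ} (hw0 : ∀ M p, 0 < w M p)
    (hw : ∃ C, 0 ≤ C ∧ ∀ M, 0 ≤ M → M ≤ m → ∀ ψ, Sm ψ → ∀ p ∈ UU, 0 ≤ p.1 → ∀ a,
      w M p * B M (ap (D M a) ψ) p ≤ C * nrm X B 1 M ψ p)
    {g : ι → Fin 4 → ℝ → Spt → ℝ} (hg : ∀ i a, Sy m sML (g i a))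
    (hYX : ∀ M, 0 ≤ M → M ≤ m → ∀ i, ∀ p ∈ UU, Y M i p = X M i p + ∑ a, g i a M p • D M a p)
    (k : ℕ) :
    ∃ C, 0 ≤ C ∧ ∀ M, 0 ≤ M → M ≤ m → ∀ ψ, Sm ψ → ∀ p ∈ UU, 0 ≤ p.1 →
      nrm Y B k M ψ p ≤ C * (1 + M * lam p / w M p) ^ k * nrm X B k M ψ p := by
  induction k with
  | zero => exact ⟨1, zero_le_one, fun M h0 h1 ψ hψ p hp _ => by simp [nrm]⟩
  | succ k ih =>
    obtain ⟨C, hC, ih⟩ := ih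
    have hG := GB_nrm hX hB k
    choose K hK hK' using fun i a => hG.leib _ _ (hg i a)
    obtain ⟨C1, hC1, h1'⟩ := com_w hX hD hB hc (fun M p => (hw0 M p).le) hw k
    set T := ∑ i, ∑ a, K i a with hT
    have hT0 : 0 ≤ T := Finset.sum_nonneg fun i _ => Finset.sum_nonneg fun a _ => hK i a
    refine ⟨1 + C * (1 + T * C1), by positivity, fun M h0 h1 ψ hψ p hp ht => ?_⟩
    have hL : 0 ≤ M * lam p := mul_nonneg h0 (zero_le_one.trans lam_ge)
    have hwp := hw0 M p
    set F := 1 + M * lam p / w M p with hF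
    have hF1 : 1 ≤ F := by have : 0 ≤ M * lam p / w M p := by positivity
                           linarith
    set N := nrm X B (k+1) M ψ p with hN
    have hN0 : 0 ≤ N := (nrm_mono hB (k+1) h0 h1 ψ hp).2
    have hY1 : ∀ i, Set.EqOn (ap (Y M i) ψ) (fun q => ap (X M i) ψ q + ∑ a, g i a M q * ap (D M a) ψ q) UU := by
      intro i q hq
      simp only [ap]
      rw [hYX M h0 h1 i q hq]
      simp
    have sD : ∀ b, Sm (ap (D M b) ψ) := fun b => hψ.ap (hD M h0 h1 b)
    have st : ∀ i, nrm X B k M (ap (Y M i) ψ) p ≤ nrm X B k M (ap (X M i) ψ) p +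
        (∑ a, K i a) * (C1 * (M * lam p / w M p) * N) := by
      intro i
      have sg : ∀ a, Sm (fun q => g i a M q * ap (D M a) ψ q) := fun a => ((hg i a).sm M h0 h1).mul (sD a)
      rw [hG.congr M h0 h1 _ _ (hY1 i) p hp]
      refine (hG.add M h0 h1 _ _ (hψ.ap (hX.sm M h0 h1 i)) (Sm.sum _ fun a _ => sg a) p hp).trans ?_
      refine add_le_add_right ((hG.sum _ h0 h1 (fun a _ => sg a) hp).trans ?_) _
      rw [Finset.sum_mul]
      refine Finset.sum_le_sum fun a _ => ?_
      refine (hK' i a M h0 h1 _ (sD a) p hp).trans ?_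
      rw [mul_assoc]
      refine mul_le_mul_of_nonneg_left ?_ (hK i a)
      have := h1' M h0 h1 ψ hψ p hp ht a
      simp only [sML]
      calc M * lam p * nrm X B k M (ap (D M a) ψ) p
          = (M * lam p / w M p) * (w M p * nrm X B k M (ap (D M a) ψ) p) := by field_simp
        _ ≤ (M * lam p / w M p) * (C1 * N) := mul_le_mul_of_nonneg_left this (by positivity)
        _ = _ := by ring
    have s2 := Finset.sum_le_sum (fun i (_ : i ∈ Finset.univ) => st i)
    rw [Finset.sum_add_distrib, ← Finset.sum_mul] at s2
    have e : N = B M ψ p + ∑ i, nrm X B k M (ap (X M i) ψ) p := rfl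
    have b0 := hB.nonneg M h0 h1 ψ p hp
    have b1 : 0 ≤ ∑ i, nrm X B k M (ap (X M i) ψ) p :=
      Finset.sum_nonneg fun i _ => (nrm_mono hB k h0 h1 _ hp).2
    have s3 : ∑ i, nrm X B k M (ap (Y M i) ψ) p ≤ (1 + T * C1) * F * N := by
      refine s2.trans ?_
      rw [← hT]
      have u1 : N ≤ F * N := le_mul_of_one_le_left hN0 hF1
      have u2 : T * (C1 * (M * lam p / w M p) * N) ≤ T * (C1 * F * N) := by
        gcongr
        linarith
      calc _ ≤ F * N + T * (C1 * F * N) := add_le_add (by linarith) u2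
        _ = _ := by ring
    have e' : nrm Y B (k+1) M ψ p = B M ψ p + ∑ i, nrm Y B k M (ap (Y M i) ψ) p := rfl
    have s4 : ∑ i, nrm Y B k M (ap (Y M i) ψ) p ≤ C * F ^ k * ((1 + T * C1) * F * N) := by
      refine (Finset.sum_le_sum fun i _ => ih M h0 h1 _ (hψ.ap (hY.sm M h0 h1 i)) p hp ht).trans ?_
      rw [← Finset.mul_sum]
      exact mul_le_mul_of_nonneg_left s3 (by positivity)
    have s5 : B M ψ p ≤ F ^ (k+1) * N := by
      have : 1 ≤ F ^ (k+1) := one_le_pow₀ hF1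
      nlinarith
    rw [e']
    calc _ ≤ _ := add_le_add s5 s4
      _ = _ := by ring
end

end
def kk : ZIdx → Fin 4 → ℝ
  | Sum.inl a => fun c => if c = a then 1 else 0
  | Sum.inr (Sum.inl _) => fun _ => 0
  | Sum.inr (Sum.inr _) => fun _ => 0

def LL : ZIdx → Fin 4 → Fin 4 → ℝ
  | Sum.inl _ => fun _ _ => 0
  | Sum.inr (Sum.inl ab) => fun c b =>
      eta ab.1 b * (if c = ab.2 then 1 else 0) - eta ab.2 b * (if c = ab.1 then 1 else 0)
  | Sum.inr (Sum.inr _) => fun c b => if c = b then 1 else 0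

def zz (i : ZIdx) (y : Fin 4 → ℝ) (c : Fin 4) : ℝ := kk i c + ∑ b, LL i c b * y b

def low (y : Fin 4 → ℝ) (a : Fin 4) : ℝ := ∑ b, eta a b * y b

lemma low_eq (y : Fin 4 → ℝ) (a : Fin 4) : low y a = Fin.cases (-y 0) (fun i => y i.succ) a := by
  refine Fin.cases ?_ (fun i => ?_) a
  · simp [low, eta]
  · simp [low, eta]

lemma zz_inl (a : Fin 4) (y c) : zz (Sum.inl a) y c = if c = a then 1 else 0 := by
  simp [zz, kk, LL]
lemma zz_om (ab : Fin 4 × Fin 4) (y c) : zz (Sum.inr (Sum.inl ab)) y c =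
    low y ab.1 * (if c = ab.2 then 1 else 0) - low y ab.2 * (if c = ab.1 then 1 else 0) := by
  simp only [zz, kk, LL, low, sub_mul, Finset.sum_sub_distrib, Finset.sum_mul, zero_add]
  congr 1 <;> exact Finset.sum_congr rfl fun _ _ => by ring
lemma zz_S (u : Unit) (y c) : zz (Sum.inr (Sum.inr u)) y c = y c := by
  simp [zz, kk, LL]

lemma xtlow_eq (M χ p a) : xtlow M χ p a = low (xtilde M χ p) a := by
  rw [low_eq]
  refine Fin.cases ?_ (fun i => ?_) a
  · simp [xtlow, xtilde, xt]
  · simp [xtlow]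

lemma mfield_eq (M : ℝ) (χ : ℝ → ℝ) (i : ZIdx) (p : Spt) :
    mfield M χ i p = ∑ c, zz i (xtilde M χ p) c • tdirVec M χ c p := by
  rcases i with a | ab | u
  · simp [mfield, zz_inl]
  · simp only [mfield, zz_om, xtlow_eq, sub_smul, Finset.sum_sub_distrib]
    simp
  · simp only [mfield, zz_S]

lemma coL_tdir (M : ℝ) (χ : ℝ → ℝ) (a α : Fin 4) (p : Spt) :
    coL α (tdirVec M χ a p) = Ainv M χ p α a := coL_toVec _ _

lemma coL_mfield (M : ℝ) (χ : ℝ → ℝ) (i : ZIdx) (α : Fin 4) (p : Spt) :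
    coL α (mfield M χ i p) = ∑ c, zz i (xtilde M χ p) c * Ainv M χ p α c := by
  rw [mfield_eq]
  simp [coL_tdir]

/-! M = 0 -/

lemma xt_zero (χ : ℝ → ℝ) (a : Fin 4) : xt 0 χ a = fun p => coL a p := by
  funext p; rw [xt_eq]; simp

lemma Amat_zero (χ : ℝ → ℝ) (p : Spt) : Amat 0 χ p = 1 := by
  ext a α
  simp only [Amat, Matrix.of_apply, xt_zero, pd_coL, Matrix.one_apply]

lemma tdir_zero (χ : ℝ → ℝ) (a : Fin 4) (p : Spt) : tdirVec 0 χ a p = dir a := by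
  apply ext_coL
  intro α
  rw [coL_tdir, Ainv, Amat_zero, coL_dir, inv_one, Matrix.one_apply]

lemma xtilde_zero (χ : ℝ → ℝ) (p : Spt) : xtilde 0 χ p = fun a => coL a p := by
  funext a; simp only [xtilde, xt_zero]

lemma mfield_zero (χ : ℝ → ℝ) (i : ZIdx) (p : Spt) : mfield 0 χ i p = toVec (zfield i p) := by
  rw [mfield_eq]
  simp only [tdir_zero]
  have : ∀ c, zz i (xtilde 0 χ p) c = zfield i p c := by
    intro c
    rw [xtilde_zero]
    have hl : ∀ a, low (fun a => coL a p) a = xlow p a := by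
      intro a
      rw [low_eq]
      refine Fin.cases ?_ (fun i => ?_) a <;> simp [xlow]
    rcases i with a | ab | u
    · rw [zz_inl]; rfl
    · rw [zz_om, hl, hl]; rfl
    · rw [zz_S]; exact (xup_eq p c).symm
  simp only [this]
  rfl

lemma rstar_zero (χ : ℝ → ℝ) (p : Spt) : rstar 0 χ p = ‖p.2‖ := by simp [rstar]

section
variable {χ : ℝ → ℝ} (hχ : ContDiff ℝ (⊤:ℕ∞) χ) (hχ1 : ∀ s, (3:ℝ)/4 ≤ s → χ s = 1)
variable {m : ℝ} (hm : m ≤ 1)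
  (hdet : ∀ M, 0 ≤ M → M ≤ m → ∀ p ∈ UU, 1/2 ≤ (Amat M χ p).det)
include hχ hχ1 hm

lemma Sy_zz (i : ZIdx) (c : Fin 4) : Sy m sR (fun M p => zz i (xtilde M χ p) c) := by
  refine ((Sy.const1 (kk i c)).mono (K := 16) (by norm_num) (fun _ _ _ p hp => one_le_R hp)).add ?_
  exact Sy.sum _ (fun b _ => (Sy_xt hχ hχ1 hm b).const_mul _) (fun _ _ _ p _ => norm_nonneg _)

lemma sML_nonneg : ∀ M, 0 ≤ M → M ≤ m → ∀ p ∈ UU, 0 ≤ sML M p := fun M h0 _ p _ =>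
  mul_nonneg h0 (zero_le_one.trans lam_ge)

lemma Sy_zz1 (i : ZIdx) (c : Fin 4) :
    Sy m sML (fun M p => zz i (xtilde M χ p) c - zz i (fun a => coL a p) c) := by
  have := Sy.sum (m := m) (W := sML) Finset.univ
    (f := fun b M p => LL i c b * (M * hh χ b p))
    (fun b _ => (Sy_Mhh hχ hχ1 m b).const_mul _) (sML_nonneg hχ hχ1 hm)
  refine this.congr (fun M _ _ p _ => ?_)
  simp only [zz, add_sub_add_left_eq_sub, ← Finset.sum_sub_distrib]
  refine Finset.sum_congr rfl fun b _ => ?_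
  rw [xtilde, xt_eq]; ring

include hdet

lemma VS_m : VS m (fun M i => mfield M χ i) := by
  intro i α
  simp only [coL_mfield]
  refine Sy.sum _ (fun c _ => ?_) (fun _ _ _ p _ => norm_nonneg _)
  exact ((Sy_zz hχ hχ1 hm i c).mul (Sy_Ainv hχ hχ1 hm hdet α c)).weq (fun M p _ => mul_one _)

lemma VSm_D : VSm m (fun M a => tdirVec M χ a) := by
  apply VSm_of
  intro M h0 h1 a α
  simp only [coL_tdir]
  exact (Sy_Ainv hχ hχ1 hm hdet α a).sm M h0 h1

lemma Sy_mdiff (i : ZIdx) (α : Fin 4) :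
    Sy m sML (fun M p => coL α (mfield M χ i p) - coL α (mfield 0 χ i p)) := by
  have h1 : ∀ c, Sy m sML (fun M p => (zz i (xtilde M χ p) c - zz i (fun a => coL a p) c) * Ainv M χ p α c) :=
    fun c => ((Sy_zz1 hχ hχ1 hm i c).mul (Sy_Ainv hχ hχ1 hm hdet α c)).weq (fun M p _ => mul_one _)
  have h2 : ∀ c, Sy m sML (fun M p => zz i (fun a => coL a p) c *
      (Ainv M χ p α c - (1 : Matrix (Fin 4) (Fin 4) ℝ) α c)) := by
    intro c
    have hz : Sy m sR (fun (_:ℝ) p => zz i (fun a => coL a p) c) := by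
      refine ((Sy.const1 (kk i c)).mono (K := 16) (by norm_num) (fun _ _ _ p hp => one_le_R hp)).add ?_
      exact Sy.sum _ (fun b _ => (Sy_coL m b).const_mul _) (fun _ _ _ p _ => norm_nonneg _)
    refine (hz.mul (Sy_Ainv1 hχ hχ1 hm hdet α c)).weq (fun M p hp => ?_)
    have := UU_r hp
    have : ‖p.2‖ ≠ 0 := by positivity
    simp only [sR, sMI, sML]
    field_simp
  have := Sy.sum (m := m) (W := sML) Finset.univ (fun c _ => (h1 c).add (h2 c)) (sML_nonneg hχ hχ1 hm)
  refine this.congr (fun M _ _ p _ => ?_)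
  simp only [coL_mfield, xtilde_zero, Ainv, Amat_zero, inv_one, ← Finset.sum_sub_distrib]
  exact Finset.sum_congr rfl fun c _ => by ring

omit hχ hχ1 hm in
lemma D_xt {M : ℝ} (h0 : 0 ≤ M) (h1 : M ≤ m) (a c : Fin 4) :
    Set.EqOn (ap (tdirVec M χ a) (xt M χ c)) (fun _ => if c = a then 1 else 0) UU := by
  intro p hp
  have := congrFun (congrFun (inv_mul_A hdet h0 h1 hp).2 c) a
  rw [Matrix.mul_apply, Matrix.one_apply] at this
  simp only []
  rw [ap_eq_sum, ← this]
  refine Finset.sum_congr rfl fun α _ => ?_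
  rw [coL_tdir, mul_comm]; rfl

lemma D_comm {M : ℝ} (h0 : 0 ≤ M) (h1 : M ≤ m) (a b : Fin 4) {ψ : Spt → ℝ} (hψ : Sm ψ) :
    Set.EqOn (ap (tdirVec M χ a) (ap (tdirVec M χ b) ψ)) (ap (tdirVec M χ b) (ap (tdirVec M χ a) ψ)) UU := by
  intro p hp
  have hV : ∀ a, DifferentiableAt ℝ (tdirVec M χ a) p := fun a =>
    ((VSm_D hχ hχ1 hm hdet M h0 h1 a).contDiffAt (UU_open.mem_nhds hp)).differentiableAt (by simp)
  have gen : ∀ ψ, Sm ψ → ap (tdirVec M χ a) (ap (tdirVec M χ b) ψ) p -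
      ap (tdirVec M χ b) (ap (tdirVec M χ a) ψ) p =
      fderiv ℝ ψ p (fderiv ℝ (tdirVec M χ b) p (tdirVec M χ a p) -
        fderiv ℝ (tdirVec M χ a) p (tdirVec M χ b p)) := by
    intro ψ hψ
    have hc : ContDiffAt ℝ (⊤:ℕ∞) ψ p := hψ.contDiffAt (UU_open.mem_nhds hp)
    have hd : DifferentiableAt ℝ (fderiv ℝ ψ) p :=
      (hc.fderiv_right (m := (⊤:ℕ∞)) (by simp)).differentiableAt (by simp)
    have hs : IsSymmSndFDerivAt ℝ ψ p := by
      refine hc.isSymmSndFDerivAt ?_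
      simp only [minSmoothness_of_isRCLikeNormedField]
      exact WithTop.coe_le_coe.2 (le_top : (2:ℕ∞) ≤ ⊤)
    have e : ∀ a b, ap (tdirVec M χ a) (ap (tdirVec M χ b) ψ) p =
        fderiv ℝ ψ p (fderiv ℝ (tdirVec M χ b) p (tdirVec M χ a p)) +
        fderiv ℝ (fderiv ℝ ψ) p (tdirVec M χ a p) (tdirVec M χ b p) := by
      intro a b
      have := (hd.hasFDerivAt.clm_apply (hV b).hasFDerivAt).fderiv
      have e2 : (ap (tdirVec M χ b) ψ) = fun q => fderiv ℝ ψ q (tdirVec M χ b q) := rfl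
      rw [ap, e2, this]
      simp
    rw [e a b, e b a, hs.eq (tdirVec M χ a p) (tdirVec M χ b p), map_sub]
    ring
  have hz : (fderiv ℝ (tdirVec M χ b) p (tdirVec M χ a p) -
        fderiv ℝ (tdirVec M χ a) p (tdirVec M χ b p)) = 0 := by
    set v := (fderiv ℝ (tdirVec M χ b) p (tdirVec M χ a p) -
        fderiv ℝ (tdirVec M χ a) p (tdirVec M χ b p)) with hv
    have hx : ∀ c, fderiv ℝ (xt M χ c) p v = 0 := by
      intro c
      rw [← gen _ ((Sy_xt hχ hχ1 hm c).sm M h0 h1), ap_congr _ (D_xt hdet h0 h1 b c) hp,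
        ap_congr _ (D_xt hdet h0 h1 a c) hp]
      simp [ap]
    have hA : (Amat M χ p).mulVec (fun α => coL α v) = 0 := by
      funext c
      have := hx c
      have e := ap_eq_sum (fun _ => v) (xt M χ c) p
      simp only [ap] at e
      rw [e] at this
      simp only [Matrix.mulVec, dotProduct, Pi.zero_apply]
      rw [← this]
      refine Finset.sum_congr rfl fun α _ => ?_
      rw [mul_comm]; rfl
    have h3 : (fun α => coL α v) = 0 := by
      have := congrArg (fun w => (Ainv M χ p).mulVec w) hA
      simp only [Matrix.mulVec_mulVec, (inv_mul_A hdet h0 h1 hp).1, Matrix.one_mulVec,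
        Matrix.mulVec_zero] at this
      exact this
    apply ext_coL
    intro α
    simpa using congrFun h3 α
  have := gen ψ hψ
  rw [hz, map_zero] at this
  linarith

lemma ap_mfield (M : ℝ) (i : ZIdx) (ψ : Spt → ℝ) :
    ap (mfield M χ i) ψ = fun p => ∑ c, zz i (xtilde M χ p) c * ap (tdirVec M χ c) ψ p := by
  funext p
  simp only [ap]
  rw [mfield_eq]
  simp

lemma Comm_m : Comm m (fun M i => mfield M χ i) (fun M a => tdirVec M χ a) (fun i a b => - LL i b a) := by
  intro M h0 h1 ψ hψ i a p hp
  simp only []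
  have sD : ∀ b, Sm (ap (tdirVec M χ b) ψ) := fun b => hψ.ap (VSm_D hχ hχ1 hm hdet M h0 h1 b)
  have sz : ∀ c, Sm (fun p => zz i (xtilde M χ p) c) := fun c => (Sy_zz hχ hχ1 hm i c).sm M h0 h1
  have hz : ∀ c, ap (tdirVec M χ a) (fun p => zz i (xtilde M χ p) c) p = LL i c a := by
    intro c
    have sx : ∀ b, Sm (fun p => xtilde M χ p b) := fun b => (Sy_xt hχ hχ1 hm b).sm M h0 h1
    simp only [zz]
    rw [ap_add (Sm.const _) (Sm.sum _ fun b _ => (Sm.const (LL i c b)).mul (sx b)) _ hp]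
    simp only []
    rw [ap_sum _ (fun b _ => (Sm.const (LL i c b)).mul (sx b)) _ hp]
    have : ∀ b, ap (tdirVec M χ a) (fun p => LL i c b * xtilde M χ p b) p =
        LL i c b * (if b = a then 1 else 0) := by
      intro b
      rw [ap_const_mul _ (sx b) _ hp]
      have := D_xt hdet h0 h1 a b hp
      simp only [] at this ⊢
      rw [← this]; rfl
    simp only [this]
    simp [ap]
  rw [ap_mfield hχ hχ1 hm hdet M i ψ, ap_mfield hχ hχ1 hm hdet M i (ap (tdirVec M χ a) ψ),
    ap_sum _ (fun c _ => (sz c).mul (sD c)) _ hp]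
  simp only []
  rw [← Finset.sum_add_distrib]
  refine Finset.sum_congr rfl fun c _ => ?_
  rw [ap_mul (sz c) (sD c) _ hp, D_comm hχ hχ1 hm hdet h0 h1 c a hψ hp]
  simp only []
  rw [hz c]
  ring

end


lemma ap_mfield' (M : ℝ) (χ : ℝ → ℝ) (i : ZIdx) (ψ : Spt → ℝ) (p : Spt) :
    ap (mfield M χ i) ψ p = ∑ c, zz i (xtilde M χ p) c * ap (tdirVec M χ c) ψ p := by
  simp only [ap]
  rw [mfield_eq]
  simp

lemma rstar_pos {χ : ℝ → ℝ} (hχb : ∀ s, 0 ≤ χ s ∧ χ s ≤ 1) {N : ℝ} (h0 : 0 ≤ N) (h1 : N ≤ 1/10000)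
    {p : Spt} (hp : p ∈ UU) : 0 < rstar N χ p := by
  have hr := UU_r hp
  have a1 := log_bd hp
  have a2 := lam_le hp
  obtain ⟨c0, c1⟩ := hχb (‖p.2‖ / (p.1 + 1))
  have : |N * χ (‖p.2‖ / (p.1 + 1)) * Real.log ‖p.2‖| ≤ (1/10000) * 1 * (15 * (17 * ‖p.2‖)) := by
    rw [abs_mul, abs_mul, abs_of_nonneg h0, abs_of_nonneg c0]
    gcongr
    linarith
  have := (abs_le.mp this).1
  simp only [rstar]
  linarith

lemma xtilde_succ (N : ℝ) (χ : ℝ → ℝ) (p : Spt) (hr : ‖p.2‖ ≠ 0) (i : Fin 3) :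
    xtilde N χ p i.succ = p.2 i * (rstar N χ p / ‖p.2‖) := by
  simp only [xtilde, xt, Fin.cases_succ, rstar]
  field_simp

lemma weight {χ : ℝ → ℝ} (hχb : ∀ s, 0 ≤ χ s ∧ χ s ≤ 1) {N : ℝ} (h0 : 0 ≤ N) (h1 : N ≤ 1/10000)
    {p : Spt} (hp : p ∈ UU) (ht : 0 ≤ p.1) (ψ : Spt → ℝ) (a : Fin 4) :
    (1 + |rstar N χ p - p.1|) * |ap (tdirVec N χ a) ψ p| ≤
      6 * (|ψ p| + ∑ i, |ap (mfield N χ i) ψ p|) := by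
  have hR := rstar_pos hχb h0 h1 hp
  have hr := UU_r hp
  have hrne : ‖p.2‖ ≠ 0 := by positivity
  set R := rstar N χ p with hRdef
  set N1 := |ψ p| + ∑ i, |ap (mfield N χ i) ψ p| with hN1
  set y := xtilde N χ p with hy
  set d : Fin 4 → ℝ := fun c => ap (tdirVec N χ c) ψ p with hd
  have hX : ∀ i, |∑ c, zz i y c * d c| ≤ N1 := by
    intro i
    have := Finset.single_le_sum (f := fun i => |ap (mfield N χ i) ψ p|) (fun i _ => abs_nonneg _)
      (Finset.mem_univ i)
    rw [← ap_mfield']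
    have h2 := abs_nonneg (ψ p)
    linarith
  have hS : |∑ c, y c * d c| ≤ N1 := by
    have := hX (Sum.inr (Sum.inr ()))
    simpa only [zz_S] using this
  have hO : ∀ b a, |low y b * d a - low y a * d b| ≤ N1 := by
    intro b a
    have := hX (Sum.inr (Sum.inl (b, a)))
    simp only [zz_om, sub_mul, Finset.sum_sub_distrib] at this
    simpa using this
  have hT : |d a| ≤ N1 := by
    have := hX (Sum.inl a)
    simpa only [zz_inl, ite_mul, one_mul, zero_mul, Finset.sum_ite_eq', Finset.sum_ite_eq,
      Finset.mem_univ, if_true] using this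
  have hsum : ∑ i : Fin 3, (p.2 i)^2 = ‖p.2‖^2 := by
    rw [EuclideanSpace.real_norm_sq_eq]
  have hsp : ∀ i : Fin 3, |p.2 i| ≤ ‖p.2‖ := fun i => by
    have := PiLp.norm_apply_le p.2 i
    simpa using this
  have y0 : y 0 = p.1 := by simp [hy, xtilde, xt]
  have ys : ∀ i : Fin 3, y i.succ = p.2 i * (R / ‖p.2‖) := fun i => xtilde_succ N χ p hrne i
  have hq : ∑ b, y b * low y b = (R - p.1) * (R + p.1) := by
    have e : ∑ i : Fin 3, y i.succ * y i.succ = R^2 := by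
      have : ∀ i : Fin 3, y i.succ * y i.succ = (p.2 i)^2 * (R / ‖p.2‖)^2 := fun i => by rw [ys]; ring
      simp only [this]
      rw [← Finset.sum_mul, hsum]
      field_simp
    rw [Fin.sum_univ_succ]
    simp only [low_eq, Fin.cases_zero, Fin.cases_succ]
    rw [e, y0]; ring
  have hyb : ∀ b, |y b| ≤ R + p.1 := by
    intro b
    refine Fin.cases ?_ (fun i => ?_) b
    · rw [y0, abs_of_nonneg ht]; linarith
    · rw [ys, abs_mul, abs_of_nonneg (by positivity : 0 ≤ R / ‖p.2‖)]
      calc _ ≤ ‖p.2‖ * (R / ‖p.2‖) := by gcongr; exact hsp i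
        _ = R := by field_simp
        _ ≤ _ := by linarith
  have hlb : ∀ b, |low y b| ≤ R + p.1 := by
    intro b
    rw [low_eq]
    refine Fin.cases ?_ (fun i => ?_) b
    · simpa using hyb 0
    · simpa using hyb i.succ
  have id1 : (∑ b, y b * low y b) * d a =
      ∑ b, y b * (low y b * d a - low y a * d b) + low y a * ∑ c, y c * d c := by
    rw [Finset.sum_mul, Finset.mul_sum, ← Finset.sum_add_distrib]
    exact Finset.sum_congr rfl fun b _ => by ring
  have hN0 : 0 ≤ N1 := (abs_nonneg _).trans hT
  have b1 : |(R - p.1) * (R + p.1) * d a| ≤ 5 * ((R + p.1) * N1) := by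
    rw [← hq, id1]
    refine (abs_add_le _ _).trans ?_
    have c1 : |∑ b, y b * (low y b * d a - low y a * d b)| ≤ 4 * ((R + p.1) * N1) := by
      refine (Finset.abs_sum_le_sum_abs _ _).trans ?_
      have : ∀ b ∈ Finset.univ, |y b * (low y b * d a - low y a * d b)| ≤ (R + p.1) * N1 := by
        intro b _
        rw [abs_mul]
        exact mul_le_mul (hyb b) (hO b a) (abs_nonneg _) (by linarith)
      refine (Finset.sum_le_sum this).trans ?_
      simp
    have c2 : |low y a * ∑ c, y c * d c| ≤ (R + p.1) * N1 := by
      rw [abs_mul]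
      exact mul_le_mul (hlb a) hS (abs_nonneg _) (by linarith)
    linarith
  rw [abs_mul, abs_mul, abs_of_pos (by linarith : 0 < R + p.1)] at b1
  have b2 : |R - p.1| * |d a| ≤ 5 * N1 := by
    have hpos : 0 < R + p.1 := by linarith
    refine le_of_mul_le_mul_left ?_ hpos
    linarith
  change (1 + |R - p.1|) * |d a| ≤ _
  linarith

section
variable {χ : ℝ → ℝ} (hχ : ContDiff ℝ (⊤:ℕ∞) χ) (hχ1 : ∀ s, (3:ℝ)/4 ≤ s → χ s = 1)
  (hχb : ∀ s, 0 ≤ χ s ∧ χ s ≤ 1)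
variable {m : ℝ} (hm : m ≤ 1/10000)
  (hdet : ∀ M, 0 ≤ M → M ≤ m → ∀ p ∈ UU, 1/2 ≤ (Amat M χ p).det)
include hχ hχ1 hm hdet

lemma VS_k {κ : ℝ → ℝ} (hκ : ∀ M, 0 ≤ M → M ≤ m → 0 ≤ κ M ∧ κ M ≤ m) :
    VS m (fun M i => mfield (κ M) χ i) := fun i a =>
  Sy.comp (κ := κ) hκ (VS_m hχ hχ1 (by linarith) hdet i a)

lemma VSm_Dk {κ : ℝ → ℝ} (hκ : ∀ M, 0 ≤ M → M ≤ m → 0 ≤ κ M ∧ κ M ≤ m) :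
    VSm m (fun M a => tdirVec (κ M) χ a) := fun M h0 h1 =>
  VSm_D hχ hχ1 (by linarith) hdet (κ M) (hκ M h0 h1).1 (hκ M h0 h1).2

lemma Comm_k {κ : ℝ → ℝ} (hκ : ∀ M, 0 ≤ M → M ≤ m → 0 ≤ κ M ∧ κ M ≤ m) :
    Comm m (fun M i => mfield (κ M) χ i) (fun M a => tdirVec (κ M) χ a) (fun i a b => - LL i b a) :=
  fun M h0 h1 =>
  Comm_m hχ hχ1 (by linarith) hdet (κ M) (hκ M h0 h1).1 (hκ M h0 h1).2

include hχb in
lemma cmp_k {κ κ' : ℝ → ℝ} (hκ : ∀ M, 0 ≤ M → M ≤ m → 0 ≤ κ M ∧ κ M ≤ m)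
    (hκ' : ∀ M, 0 ≤ M → M ≤ m → 0 ≤ κ' M ∧ κ' M ≤ m)
    (hd : ∀ i α, Sy m sML (fun M p => coL α (mfield (κ' M) χ i p) - coL α (mfield (κ M) χ i p)))
    (k : ℕ) :
    ∃ C, 0 ≤ C ∧ ∀ M, 0 ≤ M → M ≤ m → ∀ ψ, Sm ψ → ∀ p ∈ UU, 0 ≤ p.1 →
      nrm (fun M i => mfield (κ' M) χ i) absF k M ψ p ≤
        C * (1 + M * lam p / (1 + |rstar (κ M) χ p - p.1|)) ^ k *
          nrm (fun M i => mfield (κ M) χ i) absF k M ψ p := by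
  refine main_cmp (D := fun M a => tdirVec (κ M) χ a)
    (w := fun M p => 1 + |rstar (κ M) χ p - p.1|)
    (g := fun i a M p => ∑ α, Amat (κ M) χ p a α *
      (coL α (mfield (κ' M) χ i p) - coL α (mfield (κ M) χ i p)))
    (VS_k hχ hχ1 hm hdet hκ) (VS_k hχ hχ1 hm hdet hκ')
    (VSm_Dk hχ hχ1 hm hdet hκ) (GB_abs m) (Comm_k hχ hχ1 hm hdet hκ) (fun M p => by positivity)
    ⟨6, by norm_num, fun M h0 h1 ψ _ p hp ht a => ?_⟩ (fun i a => ?_) (fun M h0 h1 i p hp => ?_) k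
  · exact weight hχb (hκ M h0 h1).1 ((hκ M h0 h1).2.trans hm) hp ht ψ a
  · refine Sy.sum _ (fun α _ => ?_) (fun M h0 _ p _ => mul_nonneg h0 (zero_le_one.trans lam_ge))
    exact ((Sy.comp (κ := κ) hκ (Sy_A hχ hχ1 (by linarith : m ≤ 1) a α)).mul (hd i α)).weq
      (fun M p _ => one_mul _)
  · apply ext_coL
    intro β
    have hA := (inv_mul_A hdet (hκ M h0 h1).1 (hκ M h0 h1).2 hp).1
    rw [map_add, map_sum]
    simp only [map_smul, smul_eq_mul, coL_tdir]
    set v : Fin 4 → ℝ := fun α => coL α (mfield (κ' M) χ i p) - coL α (mfield (κ M) χ i p) with hv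
    have e : ∑ a, (∑ α, Amat (κ M) χ p a α * v α) * Ainv (κ M) χ p β a = v β := by
      have := congrFun (congrArg (fun B => Matrix.mulVec B v) hA) β
      simp only [← Matrix.mulVec_mulVec, Matrix.one_mulVec] at this
      rw [← this]
      simp only [Matrix.mulVec, dotProduct]
      exact Finset.sum_congr rfl fun a _ => mul_comm _ _
    have e2 : v β = coL β (mfield (κ' M) χ i p) - coL β (mfield (κ M) χ i p) := rfl
    rw [e, e2]; ring

lemma id_k : ∀ M, 0 ≤ M → M ≤ m → 0 ≤ (fun M => M) M ∧ (fun M => M) M ≤ m := fun M h0 h1 => ⟨h0, h1⟩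
lemma zero_k : ∀ M, 0 ≤ M → M ≤ m → (0:ℝ) ≤ (fun _ : ℝ => (0:ℝ)) M ∧ (fun _ : ℝ => (0:ℝ)) M ≤ m :=
  fun M h0 h1 => ⟨le_rfl, h0.trans h1⟩

include hχb in
lemma cmp_up (k : ℕ) :
    ∃ C, 0 ≤ C ∧ ∀ M, 0 ≤ M → M ≤ m → ∀ ψ, Sm ψ → ∀ p ∈ UU, 0 ≤ p.1 →
      nrm (fun M i => mfield M χ i) absF k M ψ p ≤
        C * (1 + M * lam p / (1 + |‖p.2‖ - p.1|)) ^ k *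
          nrm (fun _ i => mfield 0 χ i) absF k M ψ p := by
  have := cmp_k hχ hχ1 hχb hm hdet (zero_k hχ hχ1 hm hdet) (id_k hχ hχ1 hm hdet)
    (fun i α => Sy_mdiff hχ hχ1 (by linarith) hdet i α) k
  simpa only [rstar_zero] using this

include hχb in
lemma cmp_dn (k : ℕ) :
    ∃ C, 0 ≤ C ∧ ∀ M, 0 ≤ M → M ≤ m → ∀ ψ, Sm ψ → ∀ p ∈ UU, 0 ≤ p.1 →
      nrm (fun _ i => mfield 0 χ i) absF k M ψ p ≤
        C * (1 + M * lam p / (1 + |rstar M χ p - p.1|)) ^ k *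
          nrm (fun M i => mfield M χ i) absF k M ψ p :=
  cmp_k hχ hχ1 hχb hm hdet (id_k hχ hχ1 hm hdet) (zero_k hχ hχ1 hm hdet)
    (fun i α => ((Sy_mdiff hχ hχ1 (by linarith) hdet i α).neg).congr (fun M _ _ p _ => by simp)) k
end

def itr {κ : Type} (X : κ → Spt → Spt) : {k : ℕ} → (Fin k → κ) → (Spt → ℝ) → Spt → ℝ
  | 0, _, f => f
  | _+1, I, f => ap (X (I 0)) (itr X (fun j => I j.succ) f)

lemma zApply_eq (χ : ℝ → ℝ) {k : ℕ} (I : Fin k → ZIdx) (f : Spt → ℝ) :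
    zApply I f = itr (fun i => mfield 0 χ i) I f := by
  induction k with
  | zero => rfl
  | succ k ih =>
    funext p
    simp only [zApply, itr, ap, mfield_zero, ih]

lemma pdT_eq (χ : ℝ → ℝ) {k : ℕ} (I : Fin k → Fin 4) (f : Spt → ℝ) :
    pdT I f = itr (fun a => tdirVec 0 χ a) I f := by
  induction k with
  | zero => rfl
  | succ k ih =>
    funext p
    simp only [pdT, itr, ap, pd, tdir_zero, ih]

lemma xApply_eq (M : ℝ) (χ : ℝ → ℝ) {k : ℕ} (I : Fin k → ZIdx) (f : Spt → ℝ) :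
    xApply M χ I f = itr (fun i => mfield M χ i) I f := by
  induction k with
  | zero => rfl
  | succ k ih =>
    funext p
    simp only [xApply, itr, ap, ih]

lemma itr_last {κ : Type} (X : κ → Spt → Spt) {k : ℕ} (I : Fin (k+1) → κ) (f : Spt → ℝ) :
    itr X I f = itr X (fun j : Fin k => I j.castSucc) (ap (X (I (Fin.last k))) f) := by
  induction k with
  | zero => rfl
  | succ k ih =>
    have e : itr X I f = ap (X (I 0)) (itr X (fun j => I j.succ) f) := rfl
    rw [e, ih]
    rfl

lemma itr_congr {κ : Type} {X X' : κ → Spt → Spt} {O : Set Spt} (hO : IsOpen O)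
    (hX : ∀ i, Set.EqOn (X i) (X' i) O) {f g : Spt → ℝ} (h : Set.EqOn f g O) {k : ℕ} (I : Fin k → κ) :
    Set.EqOn (itr X I f) (itr X' I g) O := by
  induction k with
  | zero => exact h
  | succ k ih => exact ap_congr_open hO (ih _) (hX _)

lemma itr_zero {κ : Type} (X : κ → Spt → Spt) {k : ℕ} (I : Fin k → κ) :
    itr X I (fun _ => 0) = fun _ => 0 := by
  induction k with
  | zero => rfl
  | succ k ih =>
    funext p
    simp only [itr, ih, ap]
    simp

lemma sum_snoc {κ : Type} [Fintype κ] {j : ℕ} (F : (Fin (j+1) → κ) → ℝ)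
    (G : κ → (Fin j → κ) → ℝ) (h : ∀ I, F I = G (I (Fin.last j)) (fun l => I l.castSucc)) :
    ∑ I, F I = ∑ i, ∑ I', G i I' := by
  rw [← Fintype.sum_prod_type' (f := G)]
  refine (Fintype.sum_equiv (Fin.snocEquiv (fun _ : Fin (j+1) => κ)) _ _ ?_).symm
  rintro ⟨i, I'⟩
  rw [h]
  simp [Fin.snocEquiv]

lemma nrm_eq {κ : Type} [Fintype κ] (X : Flds κ) (B : Fnl) (k : ℕ) (M : ℝ) (f : Spt → ℝ) (p : Spt) :
    nrm X B k M f p = ∑ j ∈ Finset.range (k+1), ∑ I : Fin j → κ, B M (itr (X M) I f) p := by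
  induction k generalizing f with
  | zero => simp [nrm, itr]
  | succ k ih =>
    rw [Finset.sum_range_succ']
    have e : nrm X B (k+1) M f p = B M f p + ∑ i, nrm X B k M (ap (X M i) f) p := rfl
    rw [e, add_comm]
    congr 1
    · simp only [ih]
      rw [Finset.sum_comm]
      refine Finset.sum_congr rfl fun j _ => ?_
      exact (sum_snoc _ (fun i I' => B M (itr (X M) I' (ap (X M i) f)) p)
        (fun I => by rw [itr_last])).symm
    · simp [itr]

lemma itr_sm {κ : Type} {m : ℝ} {X : Flds κ} (hX : VSm m X) {M : ℝ} (h0 : 0 ≤ M) (h1 : M ≤ m)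
    {f : Spt → ℝ} (hf : Sm f) {k : ℕ} (I : Fin k → κ) : Sm (itr (X M) I f) := by
  induction k with
  | zero => exact hf
  | succ k ih => exact (ih _).ap (hX M h0 h1 _)

lemma nrm_single {κ : Type} [Fintype κ] {m : ℝ} (X : Flds κ) {B : Fnl} (hB : GB m B) {k : ℕ} {M : ℝ}
    (h0 : 0 ≤ M) (h1 : M ≤ m) (f : Spt → ℝ) {p : Spt} (hp : p ∈ UU) (I : Fin k → κ) :
    B M (itr (X M) I f) p ≤ nrm X B k M f p := by
  rw [nrm_eq]
  have hn : ∀ j ∈ Finset.range (k+1), 0 ≤ ∑ I : Fin j → κ, B M (itr (X M) I f) p := fun j _ =>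
    Finset.sum_nonneg fun I _ => hB.nonneg M h0 h1 _ p hp
  refine le_trans ?_ (Finset.single_le_sum hn (by simp : k ∈ Finset.range (k+1)))
  exact Finset.single_le_sum (f := fun I : Fin k → κ => B M (itr (X M) I f) p)
    (fun I _ => hB.nonneg M h0 h1 _ p hp) (Finset.mem_univ I)

section
variable {χ : ℝ → ℝ} (hχ : ContDiff ℝ (⊤:ℕ∞) χ) (hχ1 : ∀ s, (3:ℝ)/4 ≤ s → χ s = 1)
variable {m : ℝ} (hm0 : 0 ≤ m) (hm : m ≤ 1/10000)
  (hdet : ∀ M, 0 ≤ M → M ≤ m → ∀ p ∈ UU, 1/2 ≤ (Amat M χ p).det)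

lemma VS_par (χ : ℝ → ℝ) (m : ℝ) : VS m (fun (_:ℝ) a => tdirVec 0 χ a) := by
  intro a α
  simp only [tdir_zero, coL_dir]
  exact (Sy.const1 _).mono (K := 16) (by norm_num) (fun _ _ _ p hp => one_le_R hp)

include hχ hχ1 hm0 hm hdet

lemma itr_pd_comm {f : Spt → ℝ} (hf : Sm f) (c : Fin 4) {k : ℕ} (β : Fin k → Fin 4) :
    Set.EqOn (itr (fun a => tdirVec 0 χ a) β (ap (tdirVec 0 χ c) f))
      (ap (tdirVec 0 χ c) (itr (fun a => tdirVec 0 χ a) β f)) UU := by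
  induction k with
  | zero => exact fun _ _ => rfl
  | succ k ih =>
    intro p hp
    have h1 := ap_congr (tdirVec 0 χ (β 0)) (ih fun j => β j.succ) hp
    have s := itr_sm (VS_par χ m).sm le_rfl hm0 hf (fun j => β j.succ)
    have h2 := D_comm hχ hχ1 (by linarith) hdet le_rfl hm0 (β 0) c s hp
    exact h1.trans h2

lemma part_i (a : Fin 4) (jI jβ : ℕ) : ∃ C, 0 ≤ C ∧ ∀ M, 0 ≤ M → M ≤ m → ∀ φ, Sm φ → ∀ p ∈ UU,
    ∀ (I : Fin jI → ZIdx) (β : Fin jβ → Fin 4),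
    |pdT β (zApply I (fun q => tpd M χ a φ q - pd a φ q)) p| ≤ C * sMI M p *
      ∑ j ∈ Finset.range (jI+1), ∑ J : Fin j → ZIdx,
                ∑ b ∈ Finset.range (jβ+1), ∑ β' : Fin b → Fin 4,
                  ∑ c : Fin 4, |pd c (pdT β' (zApply J φ)) p| := by
  have hm1 : m ≤ 1 := by linarith
  have hz := zero_k hχ hχ1 hm hdet
  have hXP := VS_par χ m
  have hXZ := VS_k hχ hχ1 hm hdet hz
  have hD := VSm_Dk hχ hχ1 hm hdet hz
  have hB := GB_nrm hXP (GB_abs m) jβ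
  have hG := GB_nrm hXZ hB jI
  obtain ⟨C1, hC1, hQ⟩ := com_Q hXZ hD hB (Comm_k hχ hχ1 hm hdet hz) jI
  choose K hK hK' using fun α => hG.leib _ _ (Sy_Ainv1 hχ hχ1 hm1 hdet α a)
  have hT0 : 0 ≤ ∑ α, K α := Finset.sum_nonneg fun α _ => hK α
  refine ⟨(∑ α, K α) * C1, by positivity, fun M h0 h1 φ hφ p hp I β => ?_⟩
  have hW : 0 ≤ sMI M p := div_nonneg (mul_nonneg h0 (zero_le_one.trans lam_ge)) (norm_nonneg _)
  have eR : ∑ j ∈ Finset.range (jI+1), ∑ J : Fin j → ZIdx, ∑ b ∈ Finset.range (jβ+1),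
      ∑ β' : Fin b → Fin 4, ∑ c : Fin 4, |pd c (pdT β' (zApply J φ)) p| =
      nrm (fun (_:ℝ) i => mfield 0 χ i) (BD (fun (_:ℝ) a => tdirVec 0 χ a)
        (nrm (fun (_:ℝ) a => tdirVec 0 χ a) absF jβ)) jI M φ p := by
    rw [nrm_eq]
    refine Finset.sum_congr rfl fun j _ => Finset.sum_congr rfl fun J _ => ?_
    have sJ : Sm (itr (fun i => mfield 0 χ i) J φ) := itr_sm hXZ.sm h0 h1 hφ J
    simp only [BD, nrm_eq, absF]
    conv_rhs => rw [Finset.sum_comm]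
    refine Finset.sum_congr rfl fun b _ => ?_
    conv_rhs => rw [Finset.sum_comm]
    refine Finset.sum_congr rfl fun β' _ => Finset.sum_congr rfl fun c _ => ?_
    rw [itr_pd_comm hχ hχ1 hm0 hm hdet sJ c β' hp, zApply_eq χ, pdT_eq χ]
    simp only [pd, ap, tdir_zero]
  rw [eR, pdT_eq χ, zApply_eq χ]
  set g : Spt → ℝ := fun q => tpd M χ a φ q - pd a φ q with hg
  have l1 : |itr (fun a => tdirVec 0 χ a) β (itr (fun i => mfield 0 χ i) I g) p| ≤
      nrm (fun (_:ℝ) i => mfield 0 χ i) (nrm (fun (_:ℝ) a => tdirVec 0 χ a) absF jβ) jI M g p :=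
    (nrm_single (fun (_:ℝ) a => tdirVec 0 χ a) (GB_abs m) h0 h1 _ hp β).trans
      (nrm_single (fun (_:ℝ) i => mfield 0 χ i) hB h0 h1 g hp I)
  refine l1.trans ?_
  have sD : ∀ b, Sm (ap (tdirVec 0 χ b) φ) := fun b => hφ.ap (hD M h0 h1 b)
  have hge : Set.EqOn g (fun q => ∑ α, (Ainv M χ q α a - (1 : Matrix (Fin 4) (Fin 4) ℝ) α a) *
      ap (tdirVec 0 χ α) φ q) UU := by
    intro q _
    have e1 : tpd M χ a φ q = ∑ α, Ainv M χ q α a * pd α φ q := by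
      have := ap_eq_sum (tdirVec M χ a) φ q
      simp only [coL_tdir] at this
      exact this
    have e2 : ∀ α, ap (tdirVec 0 χ α) φ q = pd α φ q := fun α => by simp only [ap, tdir_zero, pd]
    simp only [hg, e1, e2, sub_mul, Finset.sum_sub_distrib, Matrix.one_apply]
    simp
  rw [hG.congr M h0 h1 _ _ hge p hp]
  have st : ∀ α, Sm (fun q => (Ainv M χ q α a - (1 : Matrix (Fin 4) (Fin 4) ℝ) α a) *
      ap (tdirVec 0 χ α) φ q) := fun α => ((Sy_Ainv1 hχ hχ1 hm1 hdet α a).sm M h0 h1).mul (sD α)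
  refine (hG.sum _ h0 h1 (fun α _ => st α) hp).trans ?_
  rw [mul_assoc, mul_assoc, Finset.sum_mul]
  refine Finset.sum_le_sum fun α _ => ?_
  refine (hK' α M h0 h1 _ (sD α) p hp).trans ?_
  have q := hQ M h0 h1 φ hφ α p hp
  calc _ ≤ K α * sMI M p * _ := mul_le_mul_of_nonneg_left q (mul_nonneg (hK α) hW)
    _ = _ := by ring
end

def VV : Set Spt := {p | -(1:ℝ) < p.1 ∧ ‖p.2‖ < (p.1+1)/4}

lemma VV_open : IsOpen VV := by
  apply IsOpen.inter
  · exact isOpen_lt continuous_const continuous_fst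
  · exact isOpen_lt (f := fun p : Spt => ‖p.2‖) (g := fun p : Spt => (p.1+1)/4) (by fun_prop) (by fun_prop)

lemma VV_of {p : Spt} (ht : 0 ≤ p.1) (hp : p ∉ UU) : p ∈ VV := by
  have : ‖p.2‖ ≤ (p.1+1)/8 := by
    by_contra h
    exact hp ⟨by linarith, not_le.mp h⟩
  exact ⟨by linarith, by linarith⟩

section
variable {χ : ℝ → ℝ} (hχ0 : ∀ s ≤ (1:ℝ)/4, χ s = 0)
include hχ0

lemma xt_VV (M : ℝ) (a : Fin 4) : Set.EqOn (xt M χ a) (xt 0 χ a) VV := by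
  intro p hp
  have h1 := hp.1
  have h2 := hp.2
  have hc : χ (‖p.2‖ / (p.1 + 1)) = 0 := by
    apply hχ0
    rw [div_le_iff₀ (by linarith)]
    linarith
  rw [xt_eq, xt_eq]
  refine Fin.cases ?_ (fun i => ?_) a
  · simp [hh]
  · simp [hh, hc]

lemma Amat_VV (M : ℝ) {p : Spt} (hp : p ∈ VV) : Amat M χ p = Amat 0 χ p := by
  ext a α
  exact ap_congr_open VV_open (xt_VV hχ0 M a) (fun _ _ => rfl : Set.EqOn (fun _ => dir α) _ VV) hp

lemma tdir_VV (M : ℝ) (a : Fin 4) : Set.EqOn (tdirVec M χ a) (tdirVec 0 χ a) VV := by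
  intro p hp
  simp only [tdirVec, Ainv, Amat_VV hχ0 M hp]

lemma mfield_VV (M : ℝ) (i : ZIdx) : Set.EqOn (mfield M χ i) (mfield 0 χ i) VV := by
  intro p hp
  have : xtilde M χ p = xtilde 0 χ p := by
    funext a
    exact xt_VV hχ0 M a hp
  rw [mfield_eq, mfield_eq, this]
  exact Finset.sum_congr rfl fun c _ => by rw [tdir_VV hχ0 M c hp]

lemma xApply_VV (M : ℝ) {k : ℕ} (I : Fin k → ZIdx) (φ : Spt → ℝ) {p : Spt} (hp : p ∈ VV) :
    xApply M χ I φ p = zApply I φ p := by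
  rw [xApply_eq, zApply_eq χ]
  exact itr_congr VV_open (mfield_VV hχ0 M) (fun _ _ => rfl) I hp

lemma diff_VV (M : ℝ) (a : Fin 4) {jI jβ : ℕ} (I : Fin jI → ZIdx) (β : Fin jβ → Fin 4)
    (φ : Spt → ℝ) {p : Spt} (hp : p ∈ VV) :
    pdT β (zApply I (fun q => tpd M χ a φ q - pd a φ q)) p = 0 := by
  rw [zApply_eq χ, pdT_eq χ]
  have h0 : Set.EqOn (fun q => tpd M χ a φ q - pd a φ q) (fun _ => 0) VV := by
    intro q hq
    simp only [tpd, pd, tdir_VV hχ0 M a hq, tdir_zero, sub_self]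
  have h1 := itr_congr VV_open (X := fun i => mfield 0 χ i) (fun _ _ _ => rfl) h0 I
  rw [itr_zero] at h1
  have h2 := itr_congr VV_open (X := fun i => tdirVec 0 χ i) (fun _ _ _ => rfl) h1 β
  rw [itr_zero] at h2
  exact h2 hp

lemma rstar_near (hχb : ∀ s, 0 ≤ χ s ∧ χ s ≤ 1) {M : ℝ} (hM : 0 ≤ M) {p : Spt} (ht : 0 ≤ p.1) :
    |rstar M χ p - ‖p.2‖| ≤ 7 * (M * Real.log (1 + ‖p.2‖)) := by
  have hr := norm_nonneg p.2
  have hL : 0 ≤ Real.log (1 + ‖p.2‖) := Real.log_nonneg (by linarith)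
  have e : rstar M χ p - ‖p.2‖ = M * χ (‖p.2‖ / (p.1 + 1)) * Real.log ‖p.2‖ := by
    simp only [rstar]; ring
  rw [e]
  obtain ⟨c0, c1⟩ := hχb (‖p.2‖ / (p.1 + 1))
  by_cases h : ‖p.2‖ ≤ 1/4
  · have : χ (‖p.2‖ / (p.1 + 1)) = 0 := by
      apply hχ0
      rw [div_le_iff₀ (by linarith)]
      linarith
    rw [this]
    simp only [mul_zero, zero_mul, abs_zero]
    positivity
  · have h' : 1/4 < ‖p.2‖ := not_le.mp h
    have l1 : |Real.log ‖p.2‖| ≤ 7 * Real.log (1 + ‖p.2‖) := by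
      rw [abs_le]
      constructor
      · have a1 : Real.log (1/4) ≤ Real.log ‖p.2‖ := Real.log_le_log (by norm_num) h'.le
        have a2 : Real.log (5/4) ≤ Real.log (1 + ‖p.2‖) := Real.log_le_log (by norm_num) (by linarith)
        have a3 : Real.log 4 ≤ 7 * Real.log (5/4) := by
          have : 7 * Real.log (5/4) = Real.log ((5/4)^7) := by
            rw [Real.log_pow]; norm_num
          rw [this]
          exact Real.log_le_log (by norm_num) (by norm_num)
        have a4 : Real.log (1/4) = - Real.log 4 := by
          rw [one_div, Real.log_inv]
        linarith
      · have : Real.log ‖p.2‖ ≤ Real.log (1 + ‖p.2‖) := Real.log_le_log (by linarith) (by linarith)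
        linarith
    rw [abs_mul, abs_mul, abs_of_nonneg hM, abs_of_nonneg c0]
    calc M * χ (‖p.2‖ / (p.1 + 1)) * |Real.log ‖p.2‖| ≤ M * 1 * (7 * Real.log (1 + ‖p.2‖)) := by gcongr
      _ = _ := by ring
end

lemma lam_conv {M w L : ℝ} (h0 : 0 ≤ M) (h1 : M ≤ 1) (hw : 1 ≤ w) (hL : 0 ≤ L) (k : ℕ) :
    (1 + M * (1 + L) / w) ^ k ≤ 2 ^ k * (1 + M * L / w) ^ k := by
  rw [← mul_pow]
  have hw' : 0 < w := by linarith
  have h2 : M * (1 + L) / w = M / w + M * L / w := by ring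
  have h3 : M / w ≤ 1 := by rw [div_le_one hw']; linarith
  have h4 : 0 ≤ M / w := by positivity
  have h5 : 0 ≤ M * L / w := by positivity
  refine pow_le_pow_left₀ ?_ ?_ k <;> rw [h2] <;> linarith

lemma up_conv {C M w L A B : ℝ} {k : ℕ} (hC : 0 ≤ C) (h0 : 0 ≤ M) (h1 : M ≤ 1) (hw : 1 ≤ w) (hL : 0 ≤ L)
    (hB : 0 ≤ B) (h : A ≤ C * (1 + M * (1 + L) / w) ^ k * B) :
    A ≤ (C * 2 ^ k + 1) * (1 + M * L / w) ^ k * B := by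
  have l := lam_conv h0 h1 hw hL k
  have h5 : 0 ≤ M * L / w := by positivity
  refine h.trans ?_
  refine mul_le_mul_of_nonneg_right ?_ hB
  calc _ ≤ C * (2 ^ k * (1 + M * L / w) ^ k) := mul_le_mul_of_nonneg_left l hC
    _ ≤ _ := by
      have : 0 ≤ (1 + M * L / w) ^ k := by positivity
      linarith

lemma dn_conv {C F A B : ℝ} {k : ℕ} (hC : 0 < C) (hF : 0 < F) (h : A ≤ C * F ^ k * B) :
    C⁻¹ * F ^ (-(k:ℝ)) * A ≤ B := by
  rw [Real.rpow_neg hF.le, Real.rpow_natCast, ← mul_inv]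
  rw [inv_mul_le_iff₀ (by positivity)]
  exact h

/-- **Comparison of flat and modified derivatives and vector fields** (Lemma 5.5):
(i) `|∂^α Z^I((∂̃_a-∂_a)φ)| ≤ C M (1+ln(1+t+r))(1+t+r)⁻¹ Σ_{|J|≤|I|,|β|≤|α|}|∂∂^βZ^Jφ|`;
(ii) `(1+M ln(1+r)/(1+|q*|))⁻¹ ≤ C (1+|q*|)/(1+|q|) ≤ C² (1+M ln(1+r)/(1+|q|))`;
(iii) `C⁻¹(1+M ln(1+r)/(1+|q*|))^{-k} Σ_{|I|≤k}|Z^Iφ| ≤ Σ_{|I|≤k}|X̃^Iφ|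
      ≤ C (1+M ln(1+r)/(1+|q|))^{k} Σ_{|I|≤k}|Z^Iφ|`. -/
theorem modified_fields_comparison
    (χ : ℝ → ℝ) (hχ : ContDiff ℝ (⊤:ℕ∞) χ)
    (hχ0 : ∀ s ≤ (1:ℝ)/4, χ s = 0) (hχ1 : ∀ s, (3:ℝ)/4 ≤ s → χ s = 1)
    (hχb : ∀ s, 0 ≤ χ s ∧ χ s ≤ 1) :
    ∃ M₀ : ℝ, 0 < M₀ ∧
    -- (i)
    (∀ (a : Fin 4) (jI jβ : ℕ) (I : Fin jI → ZIdx) (β : Fin jβ → Fin 4),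
      ∃ C : ℝ, 0 < C ∧ ∀ M : ℝ, 0 < M → M ≤ M₀ →
        ∀ φ : Spt → ℝ, ContDiff ℝ (⊤:ℕ∞) φ →
        ∀ p : Spt, 0 ≤ p.1 → p.2 ≠ 0 →
          |pdT β (zApply I (fun q => tpd M χ a φ q - pd a φ q)) p|
            ≤ C * M * (1 + Real.log (1 + p.1 + ‖p.2‖)) / (1 + p.1 + ‖p.2‖) *
              ∑ j ∈ Finset.range (jI+1), ∑ J : Fin j → ZIdx,
                ∑ b ∈ Finset.range (jβ+1), ∑ β' : Fin b → Fin 4,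
                  ∑ c : Fin 4, |pd c (pdT β' (zApply J φ)) p|) ∧
    -- (ii)
    (∃ C : ℝ, 0 < C ∧ ∀ M : ℝ, 0 < M → M ≤ M₀ →
      ∀ p : Spt, 0 ≤ p.1 → p.2 ≠ 0 →
        (1 + M * Real.log (1 + ‖p.2‖) / (1 + |rstar M χ p - p.1|))⁻¹
            ≤ C * ((1 + |rstar M χ p - p.1|) / (1 + |‖p.2‖ - p.1|)) ∧
        (1 + |rstar M χ p - p.1|) / (1 + |‖p.2‖ - p.1|)
            ≤ C * (1 + M * Real.log (1 + ‖p.2‖) / (1 + |‖p.2‖ - p.1|))) ∧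
    -- (iii)
    (∀ k : ℕ, ∃ C : ℝ, 0 < C ∧ ∀ M : ℝ, 0 < M → M ≤ M₀ →
      ∀ φ : Spt → ℝ, ContDiff ℝ (⊤:ℕ∞) φ →
      ∀ p : Spt, 0 ≤ p.1 → p.2 ≠ 0 →
        C⁻¹ * (1 + M * Real.log (1 + ‖p.2‖) / (1 + |rstar M χ p - p.1|)) ^ (-(k:ℝ))
            * (∑ j ∈ Finset.range (k+1), ∑ I : Fin j → ZIdx, |zApply I φ p|)
          ≤ (∑ j ∈ Finset.range (k+1), ∑ I : Fin j → ZIdx, |xApply M χ I φ p|) ∧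
        (∑ j ∈ Finset.range (k+1), ∑ I : Fin j → ZIdx, |xApply M χ I φ p|)
          ≤ C * (1 + M * Real.log (1 + ‖p.2‖) / (1 + |‖p.2‖ - p.1|)) ^ (k:ℝ)
            * ∑ j ∈ Finset.range (k+1), ∑ I : Fin j → ZIdx, |zApply I φ p|) := by
  obtain ⟨m, hm0, hm, hdet⟩ := exists_m hχ hχ1
  refine ⟨m, hm0, ?_, ?_, ?_⟩
  · intro a jI jβ I β
    obtain ⟨C, hC, h⟩ := part_i hχ hχ1 hm0.le hm hdet a jI jβ
    refine ⟨9 * C + 1, by positivity, fun M hM hM1 φ hφ p ht _ => ?_⟩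
    set S := ∑ j ∈ Finset.range (jI+1), ∑ J : Fin j → ZIdx,
                ∑ b ∈ Finset.range (jβ+1), ∑ β' : Fin b → Fin 4,
                  ∑ c : Fin 4, |pd c (pdT β' (zApply J φ)) p| with hS
    have hS0 : 0 ≤ S := by positivity
    have hr := norm_nonneg p.2
    have hl : 0 ≤ Real.log (1 + p.1 + ‖p.2‖) := Real.log_nonneg (by linarith)
    by_cases hp : p ∈ UU
    · refine (h M hM.le hM1 φ (Sm_of hφ) p hp I β).trans ?_
      refine mul_le_mul_of_nonneg_right ?_ hS0
      have hu := hp.2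
      have hr1 := UU_r hp
      have e1 : lam p ≤ 1 + Real.log (1 + p.1 + ‖p.2‖) := by
        have : Real.log (1 + ‖p.2‖) ≤ Real.log (1 + p.1 + ‖p.2‖) :=
          Real.log_le_log (by linarith) (by linarith)
        simp only [lam]; linarith
      have e2 : 1 / ‖p.2‖ ≤ 9 / (1 + p.1 + ‖p.2‖) := by
        rw [div_le_div_iff₀ (by linarith) (by linarith)]
        linarith
      have e3 : sMI M p ≤ 9 * (M * (1 + Real.log (1 + p.1 + ‖p.2‖)) / (1 + p.1 + ‖p.2‖)) := by
        calc sMI M p = M * lam p * (1 / ‖p.2‖) := by simp only [sMI]; ring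
          _ ≤ M * (1 + Real.log (1 + p.1 + ‖p.2‖)) * (9 / (1 + p.1 + ‖p.2‖)) := by gcongr
          _ = _ := by ring
      have e4 : 0 ≤ M * (1 + Real.log (1 + p.1 + ‖p.2‖)) / (1 + p.1 + ‖p.2‖) := by positivity
      calc C * sMI M p ≤ C * (9 * (M * (1 + Real.log (1 + p.1 + ‖p.2‖)) / (1 + p.1 + ‖p.2‖))) :=
            mul_le_mul_of_nonneg_left e3 hC
        _ ≤ (9 * C + 1) * (M * (1 + Real.log (1 + p.1 + ‖p.2‖)) / (1 + p.1 + ‖p.2‖)) := by linarith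
        _ = _ := by ring
    · rw [diff_VV hχ0 M a I β φ (VV_of ht hp), abs_zero]
      positivity
  · refine ⟨7, by norm_num, fun M hM hM1 p ht _ => ?_⟩
    have hn := rstar_near hχ0 hχb hM.le ht
    have hL : 0 ≤ Real.log (1 + ‖p.2‖) := Real.log_nonneg (by linarith [norm_nonneg p.2])
    have t1 : |rstar M χ p - p.1| ≤ |rstar M χ p - ‖p.2‖| + |‖p.2‖ - p.1| := abs_sub_le _ _ _
    have t2 : |‖p.2‖ - p.1| ≤ |rstar M χ p - ‖p.2‖| + |rstar M χ p - p.1| := by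
      have := abs_sub_le ‖p.2‖ (rstar M χ p) p.1
      rw [abs_sub_comm ‖p.2‖ (rstar M χ p)] at this
      exact this
    set K := M * Real.log (1 + ‖p.2‖) with hK
    have hK0 : 0 ≤ K := by positivity
    set x := |rstar M χ p - p.1|
    set y := |‖p.2‖ - p.1|
    have hx : 0 ≤ x := abs_nonneg _
    have hy : 0 ≤ y := abs_nonneg _
    constructor
    · have e : (1 + K / (1 + x))⁻¹ = (1 + x) / (1 + x + K) := by
        field_simp
      rw [e, ← mul_div_assoc, div_le_div_iff₀ (by positivity) (by positivity)]
      nlinarith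
    · have e : 7 * (1 + K / (1 + y)) = 7 * (1 + y + K) / (1 + y) := by
        field_simp
      rw [e]
      refine div_le_div_of_nonneg_right ?_ (by positivity)
      linarith
  · intro k
    obtain ⟨C1, hC1, h1⟩ := cmp_up hχ hχ1 hχb hm hdet k
    obtain ⟨C2, hC2, h2⟩ := cmp_dn hχ hχ1 hχb hm hdet k
    have hC : 0 < (C1 + C2) * 2 ^ k + 1 := by positivity
    refine ⟨(C1 + C2) * 2 ^ k + 1, hC, fun M hM hM1 φ hφ p ht _ => ?_⟩
    have hL : 0 ≤ Real.log (1 + ‖p.2‖) := Real.log_nonneg (by linarith [norm_nonneg p.2])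
    set SZ := ∑ j ∈ Finset.range (k+1), ∑ I : Fin j → ZIdx, |zApply I φ p| with hSZ
    set SX := ∑ j ∈ Finset.range (k+1), ∑ I : Fin j → ZIdx, |xApply M χ I φ p| with hSX
    have hSZ0 : 0 ≤ SZ := by positivity
    have hSX0 : 0 ≤ SX := by positivity
    have hF : ∀ z : ℝ, 1 ≤ 1 + M * Real.log (1 + ‖p.2‖) / (1 + |z|) := by
      intro z
      have : 0 ≤ M * Real.log (1 + ‖p.2‖) / (1 + |z|) := by positivity
      linarith
    suffices hh : SX ≤ ((C1 + C2) * 2 ^ k + 1) *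
          (1 + M * Real.log (1 + ‖p.2‖) / (1 + |‖p.2‖ - p.1|)) ^ k * SZ ∧
        SZ ≤ ((C1 + C2) * 2 ^ k + 1) *
          (1 + M * Real.log (1 + ‖p.2‖) / (1 + |rstar M χ p - p.1|)) ^ k * SX by
      refine ⟨dn_conv hC (by linarith [hF (rstar M χ p - p.1)]) hh.2, ?_⟩
      rw [Real.rpow_natCast]
      exact hh.1
    by_cases hp : p ∈ UU
    · have eZ : nrm (fun (_:ℝ) i => mfield 0 χ i) absF k M φ p = SZ := by
        rw [nrm_eq]
        simp only [absF, hSZ, zApply_eq χ]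
      have eX : nrm (fun M i => mfield M χ i) absF k M φ p = SX := by
        rw [nrm_eq]
        simp only [absF, hSX, xApply_eq]
      have g1 := h1 M hM.le hM1 φ (Sm_of hφ) p hp ht
      have g2 := h2 M hM.le hM1 φ (Sm_of hφ) p hp ht
      rw [eZ, eX] at g1 g2
      simp only [lam] at g1 g2
      have f1 := up_conv hC1 hM.le (by linarith) (by linarith [abs_nonneg (‖p.2‖ - p.1)]) hL hSZ0 g1
      have f2 := up_conv hC2 hM.le (by linarith) (by linarith [abs_nonneg (rstar M χ p - p.1)]) hL hSX0 g2
      have c1 : C1 * 2 ^ k + 1 ≤ (C1 + C2) * 2 ^ k + 1 := by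
        have : 0 ≤ C2 * 2 ^ k := by positivity
        linarith
      have c2 : C2 * 2 ^ k + 1 ≤ (C1 + C2) * 2 ^ k + 1 := by
        have : 0 ≤ C1 * 2 ^ k := by positivity
        linarith
      exact ⟨f1.trans (by gcongr), f2.trans (by gcongr)⟩
    · have e : SX = SZ := by
        refine Finset.sum_congr rfl fun j _ => Finset.sum_congr rfl fun I _ => ?_
        rw [xApply_VV hχ0 M I φ (VV_of ht hp)]
      rw [e]
      have hc1 : 1 ≤ (C1 + C2) * 2 ^ k + 1 := by
        have : 0 ≤ (C1 + C2) * 2 ^ k := by positivity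
        linarith
      have key : ∀ z : ℝ, SZ ≤ ((C1 + C2) * 2 ^ k + 1) *
          (1 + M * Real.log (1 + ‖p.2‖) / (1 + |z|)) ^ k * SZ := fun z =>
        le_mul_of_one_le_left hSZ0 (one_le_mul_of_one_le_of_one_le hc1 (one_le_pow₀ (hF z)))
      exact ⟨key _, key _⟩
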